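/- arXiv:1706.01009 — 6 statements merged into one kernel-verified Lean document; each statement's English description precedes it below -/
import Mathlib

section
/- For every positive integer n > 2 there exists a prime number p satisfying 4n < p < 5n. -/
open ArithmeticFunction in
/-- Legendre's formula: `log M!` as a sum of the von Mangoldt function. -/
theorem log_factorial_eq_sum_vonMangoldt {M N : ℕ} (h : M ≤ N) :
    Real.log (M.factorial : ℝ) =
      ∑ d ∈ Finset.Ioc 0 N, vonMangoldt d * ((M / d : ℕ) : ℝ) := by
  have h1 : Real.log (M.factorial : ℝ) =
      ∑ d ∈ Finset.Ioc 0 M, vonMangoldt d * ((M / d : ℕ) : ℝ) := by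
    rw [← sum_Ioc_mul_zeta_eq_sum, vonMangoldt_mul_zeta]
    clear h
    induction M with
    | zero => simp
    | succ k ih =>
      rw [Finset.sum_Ioc_succ_top (Nat.zero_le k), ← ih, Nat.factorial_succ, Nat.cast_mul,
        Real.log_mul (by positivity) (by positivity), log_apply, add_comm]
  rw [h1]
  refine Finset.sum_subset (Finset.Ioc_subset_Ioc_right h) fun d hd hd' => ?_
  simp only [Finset.mem_Ioc, not_and, not_le] at hd hd'
  simp [Nat.div_eq_of_lt (hd' hd.1)]

/-- Chebyshev's alternating combination of logarithms of factorials. -/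
noncomputable def chebyshevLogFactorial (N : ℕ) : ℝ :=
  Real.log (N.factorial : ℝ) - Real.log ((N / 2).factorial : ℝ) -
    Real.log ((N / 3).factorial : ℝ) - Real.log ((N / 5).factorial : ℝ) +
    Real.log ((N / 30).factorial : ℝ)

/-- `chebyshevLogFactorial N` as the sum of `k - ⌊k/2⌋ - ⌊k/3⌋ - ⌊k/5⌋ + ⌊k/30⌋` at `k = ⌊N/d⌋`,
over `d`, weighted by the von Mangoldt function. -/
theorem chebyshevLogFactorial_eq_sum (N : ℕ) :
    chebyshevLogFactorial N = ∑ d ∈ Finset.Ioc 0 N, ArithmeticFunction.vonMangoldt d *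
      (((N / d : ℕ) : ℝ) - ((N / d / 2 : ℕ) : ℝ) - ((N / d / 3 : ℕ) : ℝ) -
        ((N / d / 5 : ℕ) : ℝ) + ((N / d / 30 : ℕ) : ℝ)) := by
  unfold chebyshevLogFactorial
  rw [log_factorial_eq_sum_vonMangoldt le_rfl,
    log_factorial_eq_sum_vonMangoldt (Nat.div_le_self N 2),
    log_factorial_eq_sum_vonMangoldt (Nat.div_le_self N 3),
    log_factorial_eq_sum_vonMangoldt (Nat.div_le_self N 5),
    log_factorial_eq_sum_vonMangoldt (Nat.div_le_self N 30),
    ← Finset.sum_sub_distrib, ← Finset.sum_sub_distrib, ← Finset.sum_sub_distrib,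
    ← Finset.sum_add_distrib]
  refine Finset.sum_congr rfl fun d _ => ?_
  simp only [Nat.div_right_comm N _ d]
  ring

theorem chebyshevLogFactorial_le_psi (N : ℕ) : chebyshevLogFactorial N ≤ Chebyshev.psi N := by
  rw [chebyshevLogFactorial_eq_sum, Chebyshev.psi, Nat.floor_natCast]
  refine Finset.sum_le_sum fun d _ => ?_
  refine mul_le_of_le_one_right ArithmeticFunction.vonMangoldt_nonneg ?_
  generalize N / d = k
  have h : k + k / 30 ≤ k / 2 + k / 3 + k / 5 + 1 := by omega
  have h' : (k : ℝ) + (k / 30 : ℕ) ≤ (k / 2 : ℕ) + (k / 3 : ℕ) + (k / 5 : ℕ) + 1 := by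
    exact_mod_cast h
  linarith

theorem psi_le_chebyshevLogFactorial_add (N : ℕ) :
    Chebyshev.psi N ≤ chebyshevLogFactorial N + Chebyshev.psi (N / 6 : ℕ) := by
  rw [chebyshevLogFactorial_eq_sum, Chebyshev.psi, Chebyshev.psi, Nat.floor_natCast,
    Nat.floor_natCast,
    ← Finset.sum_sdiff (Finset.Ioc_subset_Ioc_right (a := 0) (Nat.div_le_self N 6)),
    ← Finset.sum_sdiff (Finset.Ioc_subset_Ioc_right (a := 0) (Nat.div_le_self N 6))]
  gcongr ?_ + _
  refine le_add_of_le_of_nonneg (Finset.sum_le_sum fun d hd => ?_)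
    (Finset.sum_nonneg fun d _ => ?_)
  · refine le_mul_of_one_le_right ArithmeticFunction.vonMangoldt_nonneg ?_
    simp only [Finset.mem_sdiff, Finset.mem_Ioc, not_and, not_le] at hd
    obtain ⟨⟨hd0, hdN⟩, hd6⟩ := hd
    have h1 : 1 ≤ N / d := (Nat.one_le_div_iff hd0).2 hdN
    have h6 : N / d < 6 := by
      rw [Nat.div_lt_iff_lt_mul hd0]
      have := hd6 hd0
      omega
    generalize N / d = k at h1 h6
    have h : k / 2 + k / 3 + k / 5 + 1 ≤ k + k / 30 := by omega
    have h' : ((k / 2 : ℕ) : ℝ) + (k / 3 : ℕ) + (k / 5 : ℕ) + 1 ≤ k + (k / 30 : ℕ) := by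
      exact_mod_cast h
    linarith
  · refine mul_nonneg ArithmeticFunction.vonMangoldt_nonneg ?_
    generalize N / d = k
    have h : k / 2 + k / 3 + k / 5 ≤ k + k / 30 := by omega
    have h' : ((k / 2 : ℕ) : ℝ) + (k / 3 : ℕ) + (k / 5 : ℕ) ≤ k + (k / 30 : ℕ) := by
      exact_mod_cast h
    linarith

/-- The convex function `x log x - x` lies above its tangent lines. -/
theorem mul_log_sub_self_tangent_le {x y : ℝ} (hx : 0 < x) (hy : 0 ≤ y) :
    x * Real.log x - x + (y - x) * Real.log x ≤ y * Real.log y - y := by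
  rcases hy.eq_or_lt with rfl | hy
  · simp only [zero_mul, sub_zero, zero_sub]; linarith
  have h := Real.one_sub_inv_le_log_of_pos (div_pos hy hx)
  rw [Real.log_div hy.ne' hx.ne', inv_div] at h
  have h2 := mul_le_mul_of_nonneg_left h hy.le
  have h3 : y * (1 - x / y) = y - x := by field_simp
  linarith

theorem mul_log_sub_self_le_log_factorial (N : ℕ) :
    N * Real.log N - N ≤ Real.log (N.factorial : ℝ) := by
  induction N with
  | zero => simp
  | succ k ih =>
    rw [Nat.factorial_succ, Nat.cast_mul, Real.log_mul (by positivity) (by positivity)]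
    have := mul_log_sub_self_tangent_le (x := (k + 1 : ℕ)) (y := k) (by positivity) (by positivity)
    push_cast at this ⊢
    linarith

theorem log_factorial_le_mul_log_sub_self {N : ℕ} (hN : 1 ≤ N) :
    Real.log (N.factorial : ℝ) ≤ N * Real.log N - N + 1 + Real.log N := by
  induction N, hN using Nat.le_induction with
  | base => simp
  | succ k hk ih =>
    have hk' : (0 : ℝ) < k := by exact_mod_cast hk
    rw [Nat.factorial_succ, Nat.cast_mul, Real.log_mul (by positivity) (by positivity)]
    have h := Real.one_sub_inv_le_log_of_pos (x := (k + 1) / (k : ℝ)) (by positivity)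
    rw [Real.log_div (by positivity) hk'.ne', inv_div] at h
    have h2 := mul_le_mul_of_nonneg_left h (by positivity : (0 : ℝ) ≤ k + 1)
    have h3 : ((k : ℝ) + 1) * (1 - k / (k + 1)) = 1 := by field_simp; ring
    push_cast
    linarith

/-- Stirling's approximation of `log ⌊x⌋!` with a logarithmic error. -/
theorem abs_log_factorial_floor_sub_le {x : ℝ} (hx : 0 < x) :
    |Real.log (⌊x⌋₊.factorial : ℝ) - (x * Real.log x - x)| ≤ 1 + Real.log (x + 1) := by
  have hfl := Nat.floor_le hx.le
  have hlt := Nat.lt_floor_add_one x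
  have hlog0 : 0 ≤ Real.log (x + 1) := Real.log_nonneg (by linarith)
  have hlogx : Real.log x ≤ Real.log (x + 1) := Real.log_le_log hx (by linarith)
  rcases lt_or_ge x 1 with h1 | h1
  · rw [Nat.floor_eq_zero.2 h1]
    have := mul_log_sub_self_tangent_le one_pos hx.le
    simp only [Real.log_one, mul_zero] at this
    have h2 : x * Real.log x ≤ 0 :=
      mul_nonpos_of_nonneg_of_nonpos hx.le (Real.log_nonpos hx.le h1.le)
    simp only [Nat.factorial_zero, Nat.cast_one, Real.log_one]
    rw [abs_le]
    constructor <;> linarith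
  · have hN : 1 ≤ ⌊x⌋₊ := Nat.one_le_floor_iff x |>.2 h1
    generalize ⌊x⌋₊ = N at *
    have hN' : (1 : ℝ) ≤ N := by exact_mod_cast hN
    have hlogN : 0 ≤ Real.log N := Real.log_nonneg hN'
    have hlogNx : Real.log N ≤ Real.log x := Real.log_le_log (by linarith) hfl
    have hl := mul_log_sub_self_le_log_factorial N
    have hu := log_factorial_le_mul_log_sub_self hN
    have t1 := mul_log_sub_self_tangent_le (x := N) (y := x) (by linarith) hx.le
    have t2 := mul_log_sub_self_tangent_le (x := x) (y := N) hx (by linarith)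
    have e1 : 0 ≤ (x - N) * Real.log N := mul_nonneg (by linarith) hlogN
    have e2 : (x - N) * Real.log x ≤ 1 * Real.log x :=
      mul_le_mul_of_nonneg_right (by linarith) (by linarith)
    rw [abs_le]
    constructor <;> linarith

/-- The constant in Chebyshev's bounds for `ψ`. -/
noncomputable def chebyshevConst : ℝ :=
  14 / 30 * Real.log 2 + 9 / 30 * Real.log 3 + 5 / 30 * Real.log 5

theorem lt_chebyshevConst : 0.92 < chebyshevConst := by
  unfold chebyshevConst
  linarith [Real.log_two_gt_d9, Real.log_three_gt_d9, Real.log_five_gt_d9]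

theorem abs_chebyshevLogFactorial_sub_le (N : ℕ) :
    |chebyshevLogFactorial N - chebyshevConst * N| ≤ 15 * √(N : ℝ) := by
  rcases N.eq_zero_or_pos with rfl | hN
  · simp [chebyshevLogFactorial]
  have hN' : (1 : ℝ) ≤ N := by exact_mod_cast hN
  have hN0 : (0 : ℝ) < N := by linarith
  have key (m : ℕ) (hm : 1 ≤ m) :
      |Real.log ((N / m).factorial : ℝ) -
        (N / m * (Real.log N - Real.log m) - N / m)| ≤ 1 + Real.log (N + 1) := by
    have hm' : (1 : ℝ) ≤ m := by exact_mod_cast hm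
    have h := abs_log_factorial_floor_sub_le (x := (N : ℝ) / m) (by positivity)
    rw [Nat.floor_div_natCast, Nat.floor_natCast,
      Real.log_div hN0.ne' (by positivity)] at h
    refine h.trans ?_
    gcongr
    exact div_le_self hN0.le hm'
  have hlog : Real.log (N + 1) ≤ 2 * √(N : ℝ) := by
    have hs : (N : ℝ) + 1 ≤ (√(N : ℝ) + 1) ^ 2 := by
      nlinarith [Real.sq_sqrt hN0.le, Real.sqrt_nonneg (N : ℝ)]
    have h1 := Real.log_le_log (by linarith) hs
    rw [Real.log_pow] at h1
    have h2 := Real.log_le_sub_one_of_pos (x := √(N : ℝ) + 1) (by positivity)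
    push_cast at h1
    linarith
  have hsq : 1 ≤ √(N : ℝ) := Real.one_le_sqrt.2 hN'
  have h1 := abs_le.1 (key 1 le_rfl)
  have h2 := abs_le.1 (key 2 (by norm_num))
  have h3 := abs_le.1 (key 3 (by norm_num))
  have h5 := abs_le.1 (key 5 (by norm_num))
  have h30 := abs_le.1 (key 30 (by norm_num))
  have hlog30 : Real.log 30 = Real.log 2 + Real.log 3 + Real.log 5 := by
    rw [← Real.log_mul (by norm_num) (by norm_num), ← Real.log_mul (by norm_num) (by norm_num)]
    norm_num
  simp only [Nat.div_one, Nat.cast_one, Real.log_one, Nat.cast_ofNat, hlog30] at h1 h2 h3 h5 h30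
  unfold chebyshevLogFactorial chebyshevConst
  rw [abs_le]
  constructor <;> linarith

theorem chebyshevConst_mul_sub_le_psi (N : ℕ) :
    chebyshevConst * N - 15 * √(N : ℝ) ≤ Chebyshev.psi N := by
  linarith [chebyshevLogFactorial_le_psi N, (abs_le.1 (abs_chebyshevLogFactorial_sub_le N)).1]

theorem psi_le_chebyshevConst_mul_add (N : ℕ) :
    Chebyshev.psi N ≤ 6 / 5 * chebyshevConst * N + 26 * √(N : ℝ) := by
  induction N using Nat.strong_induction_on with
  | _ N ih =>
    rcases N.eq_zero_or_pos with rfl | hN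
    · simp
    have h := ih (N / 6) (Nat.div_lt_self hN (by norm_num))
    have hdiv : ((N / 6 : ℕ) : ℝ) ≤ N / 6 := by exact_mod_cast Nat.cast_div_le (α := ℝ)
    have hsqrt : √((N / 6 : ℕ) : ℝ) ≤ 0.42 * √(N : ℝ) := by
      rw [Real.sqrt_le_left (by positivity), mul_pow, Real.sq_sqrt (by positivity)]
      linarith [(by positivity : (0 : ℝ) ≤ N)]
    have hmul := mul_le_mul_of_nonneg_left hdiv
      (by linarith [lt_chebyshevConst] : 0 ≤ 6 / 5 * chebyshevConst)
    linarith [psi_le_chebyshevLogFactorial_add N, Real.sqrt_nonneg (N : ℝ),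
      (abs_le.1 (abs_chebyshevLogFactorial_sub_le N)).2]

theorem theta_four_mul_lt_theta_five_mul {n : ℕ} (hn : 1000000 ≤ n) :
    Chebyshev.theta (4 * n : ℕ) < Chebyshev.theta (5 * n : ℕ) := by
  have hn' : (1000000 : ℝ) ≤ n := by exact_mod_cast hn
  have hupper := psi_le_chebyshevConst_mul_add (4 * n)
  have hlower := chebyshevConst_mul_sub_le_psi (5 * n)
  have htheta := Chebyshev.theta_le_psi (4 * n : ℕ)
  have hdiff := Chebyshev.psi_sub_theta_le (x := (5 * n : ℕ)) (by push_cast; linarith)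
  push_cast at *
  obtain ⟨s, hs0, hs⟩ : ∃ s : ℝ, 0 ≤ s ∧ (n : ℝ) = s ^ 2 :=
    ⟨√n, Real.sqrt_nonneg _, (Real.sq_sqrt (by positivity)).symm⟩
  have hs1000 : 1000 ≤ s := by nlinarith
  have h4 : √(4 * n : ℝ) = 2 * s := by
    rw [hs, show 4 * s ^ 2 = (2 * s) ^ 2 by ring, Real.sqrt_sq (by positivity)]
  set t := √(5 * n : ℝ) with ht
  have ht2 : t ^ 2 = 5 * n := Real.sq_sqrt (by positivity)
  have ht0 : 0 < t := Real.sqrt_pos.2 (by positivity)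
  have hts : t ≤ 2.24 * s := by
    rw [ht, Real.sqrt_le_left (by positivity)]
    nlinarith
  have hlog : Real.log (5 * n) ≤ 2 * (t / 1024 + 5.932) := by
    rw [← ht2, Real.log_pow]
    have h1 := Real.log_le_sub_one_of_pos (x := t / 1024) (by positivity)
    rw [Real.log_div ht0.ne' (by norm_num), show (1024 : ℝ) = 2 ^ 10 by norm_num,
      Real.log_pow] at h1
    push_cast at h1 ⊢
    linarith [Real.log_two_lt_d9]
  have herr : 2 * t * Real.log (5 * n) ≤ 2 * t * (2 * (t / 1024 + 5.932)) := by gcongr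
  rw [h4] at hupper
  have hA := mul_lt_mul_of_pos_right lt_chebyshevConst (by linarith : (0 : ℝ) < n)
  nlinarith

theorem exists_prime_of_theta_lt {a b : ℕ} (h : Chebyshev.theta a < Chebyshev.theta b) :
    ∃ p : ℕ, p.Prime ∧ a < p ∧ p ≤ b := by
  by_contra! hno
  refine h.not_ge ?_
  rw [Chebyshev.theta, Chebyshev.theta, Nat.floor_natCast, Nat.floor_natCast]
  refine Finset.sum_le_sum_of_subset_of_nonneg (fun p hp => ?_)
    fun p _ _ => Real.log_natCast_nonneg p
  simp only [Finset.mem_filter, Finset.mem_Ioc] at hp ⊢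
  exact ⟨⟨hp.1.1, not_lt.1 fun hap => (hno p hp.2 hap).not_ge hp.1.2⟩, hp.2⟩

/-- A chain of primes with small enough gaps supplies a prime between `4 * n` and `5 * n`
for every `4 * n` in the range of the chain. -/
theorem exists_prime_of_isChain (n : ℕ) (l : List ℕ) (p : ℕ)
    (hl : List.IsChain (fun p q => q < 5 * ((p + 3) / 4)) (p :: l))
    (hprime : ∀ q ∈ l, q.Prime) (hp : p ≤ 4 * n) (hlast : 4 * n < l.getLastD p) :
    ∃ q : ℕ, q.Prime ∧ 4 * n < q ∧ q < 5 * n := by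
  induction l generalizing p with
  | nil => simp at hlast; omega
  | cons q l ih =>
    rw [List.isChain_cons_cons] at hl
    rcases lt_or_ge (4 * n) q with hq | hq
    · exact ⟨q, hprime q (by simp), hq, by omega⟩
    · rw [List.getLastD_cons] at hlast
      exact ih q hl.2 (fun r hr => hprime r (by simp [hr])) hq hlast

theorem stmt_0 (n : ℕ) (hn : 2 < n) : ∃ p : ℕ, p.Prime ∧ 4 * n < p ∧ p < 5 * n := by
  rcases lt_or_ge n 1000000 with hlt | hge
  · refine exists_prime_of_isChain n [13, 19, 23, 29, 37, 47, 59, 73, 89, 113, 139, 173, 211, 263,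
      317, 397, 499, 619, 773, 967, 1201, 1499, 1873, 2341, 2927, 3659, 4567, 5701, 7129, 8893,
      11119, 13883, 17351, 21683, 27103, 33871, 42337, 52919, 66137, 82657, 103319, 129127, 161407,
      201757, 252193, 315223, 394019, 492523, 615623, 769487, 961853, 1202317, 1502887, 1878593,
      2348239, 2935279, 3669097, 4586347] 12 (by norm_num) ?_ (by omega) ?_
    · simp only [List.forall_mem_cons]
      norm_num
    · simp only [List.getLastD_cons, List.getLastD_nil]
      omega
  · obtain ⟨p, hp, h4, h5⟩ := exists_prime_of_theta_lt (theta_four_mul_lt_theta_five_mul hge)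
    refine ⟨p, hp, h4, lt_of_le_of_ne h5 ?_⟩
    rintro rfl
    exact Nat.not_prime_mul (by norm_num) (by omega) hp
end

section
/- For every positive integer n > 4 there exists a prime number p satisfying 8n < p < 9n. -/
open Finset Real
open ArithmeticFunction (sum_Ioc_mul_zeta_eq_sum vonMangoldt_mul_zeta vonMangoldt_nonneg)
open scoped Chebyshev ArithmeticFunction.vonMangoldt Nat

/-! ### The logarithm of a factorial -/

lemma log_factorial_eq_sum_vonMangoldt_s2 (N : ℕ) :
    log (N ! : ℝ) = ∑ m ∈ Ioc 0 N, Λ m * ((N / m : ℕ) : ℝ) := by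
  have h := sum_Ioc_mul_zeta_eq_sum Λ N
  rw [vonMangoldt_mul_zeta] at h
  rw [← h]
  clear h
  induction N with
  | zero => simp
  | succ N ih =>
    rw [Finset.sum_Ioc_succ_top (Nat.zero_le N), ← ih, Nat.factorial_succ, Nat.cast_mul,
      Real.log_mul (by positivity) (by positivity), ArithmeticFunction.log_apply, add_comm]

lemma log_factorial_div_eq_sum_vonMangoldt (x e : ℕ) :
    log ((x / e)! : ℝ) = ∑ m ∈ Ioc 0 x, Λ m * ((x / m / e : ℕ) : ℝ) := by
  rw [log_factorial_eq_sum_vonMangoldt_s2]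
  simp_rw [Nat.div_div_eq_div_mul, mul_comm e]
  refine Finset.sum_subset (Finset.Ioc_subset_Ioc_right (Nat.div_le_self x e)) fun m hm hm' ↦ ?_
  have h : x / e < m := by
    simp only [Finset.mem_Ioc] at hm hm'
    omega
  rw [mul_comm m, ← Nat.div_div_eq_div_mul, Nat.div_eq_of_lt h]
  simp

lemma one_sub_div_le_log_sub_log {a b : ℝ} (ha : 0 < a) (hb : 0 < b) :
    1 - a / b ≤ log b - log a := by
  have := Real.log_le_sub_one_of_pos (div_pos ha hb)
  rw [Real.log_div ha.ne' hb.ne'] at this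
  linarith

lemma sub_le_mul_log_sub_log {a b : ℝ} (ha : 0 < a) (hb : 0 < b) :
    b - a ≤ b * (log b - log a) := by
  have := mul_le_mul_of_nonneg_left (one_sub_div_le_log_sub_log ha hb) hb.le
  rwa [mul_sub, mul_div_cancel₀ _ hb.ne', mul_one] at this

lemma log_factorial_bounds {N : ℕ} (hN : 1 ≤ N) :
    N * log N - N ≤ log (N ! : ℝ) ∧ log (N ! : ℝ) ≤ N * log N - N + log N + 1 := by
  induction N, hN using Nat.le_induction with
  | base => norm_num
  | succ N hN ih =>
    have hN' : (0 : ℝ) < N := by exact_mod_cast hN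
    have h₁ := sub_le_mul_log_sub_log hN' (by linarith : (0 : ℝ) < N + 1)
    have h₂ := sub_le_mul_log_sub_log (by linarith : (0 : ℝ) < N + 1) hN'
    rw [Nat.factorial_succ, Nat.cast_mul, Real.log_mul (by positivity) (by positivity)]
    push_cast
    constructor <;> nlinarith [ih.1, ih.2]

lemma abs_log_factorial_div_sub_le {x e : ℕ} (he : 0 < e) (hex : e ≤ x) :
    |log ((x / e)! : ℝ) - ((x : ℝ) / e * log ((x : ℝ) / e) - (x : ℝ) / e)| ≤ log x + 1 := by
  have hN : 1 ≤ x / e := (Nat.one_le_div_iff he).mpr hex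
  obtain ⟨h₁, h₂⟩ := log_factorial_bounds hN
  have hN₁ : (1 : ℝ) ≤ (x / e : ℕ) := by exact_mod_cast hN
  have he' : (1 : ℝ) ≤ e := by exact_mod_cast he
  have hNy : ((x / e : ℕ) : ℝ) ≤ (x : ℝ) / e := Nat.cast_div_le
  have hyN : (x : ℝ) / e < (x / e : ℕ) + 1 := by
    rw [div_lt_iff₀ (by linarith)]
    exact_mod_cast Nat.lt_mul_of_div_lt (Nat.lt_succ_self _) he
  have hyx : (x : ℝ) / e ≤ x := div_le_self (by positivity) he'
  generalize ((x / e : ℕ) : ℝ) = N at *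
  generalize (x : ℝ) / e = y at *
  have hN₀ : 0 < N := by linarith
  have hy₀ : 0 < y := by linarith
  have h₃ := sub_le_mul_log_sub_log hN₀ hy₀
  have h₄ := sub_le_mul_log_sub_log hy₀ hN₀
  have h₅ : log y ≤ log x := Real.log_le_log hy₀ hyx
  have h₆ : log N ≤ log y := Real.log_le_log hN₀ hNy
  have h₇ : 0 ≤ log N := Real.log_nonneg hN₁
  rw [abs_le]
  constructor <;> nlinarith

/-! ### The sieve weights -/

/-- Pairs `(e, a)` such that `∑ a * ⌊t / e⌋` is at most the indicator function of `[8, 9)`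
plus that of `[8720, ∞)`. -/
def sieveWeights : List (ℕ × ℤ) :=
  [(8, 1), (9, -1), (16, -1), (18, 1), (24, -1), (27, 1), (40, -1), (45, 1), (48, 1), (54, -1),
    (56, -1), (63, 1), (80, 1), (84, -1), (90, -1), (112, 1), (120, 2), (126, -1), (135, -2),
    (144, -1), (168, 3), (189, -1), (240, -3), (252, 1), (270, 3), (280, 2), (315, -2), (336, -2),
    (360, -1), (378, 1), (420, 3), (504, -1), (540, -1), (560, -2), (630, 2), (720, 3), (840, -8),
    (945, 6), (1008, 1), (1080, 1), (1260, -4), (1680, 7), (1890, -6), (2160, -2), (2520, 2),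
    (3780, 1), (5040, 2), (7560, 3), (15120, 5)]

/-- The exponents of `2`, `3`, `5` and `7` in each modulus of `sieveWeights`, and its weight. -/
def sieveExponents : List (ℕ × ℕ × ℕ × ℕ × ℤ) :=
  [(3, 0, 0, 0, 1), (0, 2, 0, 0, -1), (4, 0, 0, 0, -1), (1, 2, 0, 0, 1), (3, 1, 0, 0, -1),
    (0, 3, 0, 0, 1), (3, 0, 1, 0, -1), (0, 2, 1, 0, 1), (4, 1, 0, 0, 1), (1, 3, 0, 0, -1),
    (3, 0, 0, 1, -1), (0, 2, 0, 1, 1), (4, 0, 1, 0, 1), (2, 1, 0, 1, -1), (1, 2, 1, 0, -1),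
    (4, 0, 0, 1, 1), (3, 1, 1, 0, 2), (1, 2, 0, 1, -1), (0, 3, 1, 0, -2), (4, 2, 0, 0, -1),
    (3, 1, 0, 1, 3), (0, 3, 0, 1, -1), (4, 1, 1, 0, -3), (2, 2, 0, 1, 1), (1, 3, 1, 0, 3),
    (3, 0, 1, 1, 2), (0, 2, 1, 1, -2), (4, 1, 0, 1, -2), (3, 2, 1, 0, -1), (1, 3, 0, 1, 1),
    (2, 1, 1, 1, 3), (3, 2, 0, 1, -1), (2, 3, 1, 0, -1), (4, 0, 1, 1, -2), (1, 2, 1, 1, 2),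
    (4, 2, 1, 0, 3), (3, 1, 1, 1, -8), (0, 3, 1, 1, 6), (4, 2, 0, 1, 1), (3, 3, 1, 0, 1),
    (2, 2, 1, 1, -4), (4, 1, 1, 1, 7), (1, 3, 1, 1, -6), (4, 3, 1, 0, -2), (3, 2, 1, 1, 2),
    (2, 3, 1, 1, 1), (4, 2, 1, 1, 2), (3, 3, 1, 1, 3), (4, 3, 1, 1, 5)]

lemma sieveWeights_eq_map : sieveWeights =
    sieveExponents.map fun v ↦ (2 ^ v.1 * 3 ^ v.2.1 * 5 ^ v.2.2.1 * 7 ^ v.2.2.2.1, v.2.2.2.2) := by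
  norm_num [sieveWeights, sieveExponents]

/-- The value at `t` of the step function attached to a list of weights. -/
def stepSum (L : List (ℕ × ℤ)) (t : ℕ) : ℤ :=
  (L.map fun w ↦ w.2 * ((t / w.1 : ℕ) : ℤ)).sum

lemma stepSum_mul_add {P : ℕ} {L : List (ℕ × ℤ)} (hL : ∀ w ∈ L, 0 < w.1 ∧ w.1 ∣ P) (q r : ℕ) :
    stepSum L (P * q + r) = stepSum L P * q + stepSum L r := by
  induction L with
  | nil => simp [stepSum]
  | cons w L ih =>
    have ih := ih fun v hv ↦ hL v (List.mem_cons_of_mem _ hv)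
    obtain ⟨hw, k, rfl⟩ := hL w List.mem_cons_self
    simp only [stepSum, List.map_cons, List.sum_cons] at ih ⊢
    rw [ih, mul_assoc, Nat.mul_add_div hw, Nat.mul_div_cancel_left _ hw]
    push_cast
    ring

/-- The value at `t` of the step function attached to a list of natural number weights. -/
def natStepSum (L : List (ℕ × ℕ)) (t : ℕ) : ℕ :=
  L.foldr (fun w s ↦ Nat.add (Nat.mul w.2 (Nat.div t w.1)) s) 0

lemma stepSum_add_natStepSum (L : List (ℕ × ℤ)) (t : ℕ) :
    stepSum L t + natStepSum ((L.filter (·.2 < 0)).map fun w ↦ (w.1, w.2.natAbs)) t =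
      natStepSum ((L.filter (0 ≤ ·.2)).map fun w ↦ (w.1, w.2.natAbs)) t := by
  induction L with
  | nil => simp [stepSum, natStepSum]
  | cons w L ih =>
    have hdiv : ∀ a b : ℕ, Nat.div a b = a / b := fun _ _ ↦ rfl
    simp only [stepSum, List.map_cons, List.sum_cons] at ih ⊢
    by_cases hw : w.2 < 0
    · have hw' : ¬ 0 ≤ w.2 := not_le.mpr hw
      simp only [hw, hw', decide_true, decide_false, List.filter_cons, if_true, natStepSum,
        List.map_cons, List.foldr_cons, Bool.false_eq_true, if_false, Nat.add_eq, Nat.mul_eq,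
        hdiv] at ih ⊢
      rw [← ih, Nat.cast_add, Nat.cast_mul, Int.ofNat_natAbs_of_nonpos hw.le]
      ring
    · have hw' : 0 ≤ w.2 := not_lt.mp hw
      simp only [hw, hw', decide_true, decide_false, List.filter_cons, if_true, natStepSum,
        List.map_cons, List.foldr_cons, Bool.false_eq_true, if_false, Nat.add_eq, Nat.mul_eq,
        hdiv] at ih ⊢
      rw [Nat.cast_add, Nat.cast_mul, ← ih, Int.natAbs_of_nonneg hw']
      ring

/-- The absolute values of the negative entries of `sieveWeights`. -/
def negSieveWeights : List (ℕ × ℕ) :=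
  [(9, 1), (16, 1), (24, 1), (40, 1), (54, 1), (56, 1), (84, 1), (90, 1), (126, 1), (135, 2),
    (144, 1), (189, 1), (240, 3), (315, 2), (336, 2), (360, 1), (504, 1), (540, 1), (560, 2),
    (840, 8), (1260, 4), (1890, 6), (2160, 2)]

/-- The positive entries of `sieveWeights`. -/
def posSieveWeights : List (ℕ × ℕ) :=
  [(8, 1), (18, 1), (27, 1), (45, 1), (48, 1), (63, 1), (80, 1), (112, 1), (120, 2), (168, 3),
    (252, 1), (270, 3), (280, 2), (378, 1), (420, 3), (630, 2), (720, 3), (945, 6), (1008, 1),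
    (1080, 1), (1680, 7), (2520, 2), (3780, 1), (5040, 2), (7560, 3), (15120, 5)]

/-- The residues modulo `72` of the multiples of `8`, `9` and `12`. -/
def breakpoints : List ℕ :=
  [0, 8, 9, 12, 16, 18, 24, 27, 32, 36, 40, 45, 48, 54, 56, 60, 63, 64]

lemma natStepSum_posSieveWeights_le :
    ∀ i < 210, ∀ j ∈ breakpoints, natStepSum posSieveWeights (72 * i + j) ≤
      natStepSum negSieveWeights (72 * i + j) +
        ((if 72 * i + j = 8 then 1 else 0) + (if 8720 ≤ 72 * i + j then 1 else 0)) := by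
  decide +kernel

lemma exists_breakpoint : ∀ r < 72, ∃ j ∈ breakpoints,
    j ≤ r ∧ j / 8 = r / 8 ∧ j / 9 = r / 9 ∧ j / 12 = r / 12 := by
  decide +kernel

lemma stepSum_sieveWeights_congr {s t : ℕ} (h₈ : s / 8 = t / 8) (h₉ : s / 9 = t / 9)
    (h₁₂ : s / 12 = t / 12) : stepSum sieveWeights s = stepSum sieveWeights t := by
  have hL : ∀ w ∈ sieveWeights, 8 ∣ w.1 ∨ 9 ∣ w.1 ∨ 12 ∣ w.1 := by decide +kernel
  unfold stepSum
  congr 1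
  refine List.map_congr_left fun w hw ↦ ?_
  obtain ⟨k, hk⟩ | ⟨k, hk⟩ | ⟨k, hk⟩ := hL w hw <;>
    simp only [hk, ← Nat.div_div_eq_div_mul, h₈, h₉, h₁₂]

lemma stepSum_sieveWeights_le_of_lt {t : ℕ} (ht : t < 15120) :
    stepSum sieveWeights t ≤ (if t = 8 then 1 else 0) + (if 8720 ≤ t then 1 else 0) := by
  obtain ⟨j, hj, hjt, h₈, h₉, h₁₂⟩ := exists_breakpoint (t % 72) (by omega)
  have h := natStepSum_posSieveWeights_le (t / 72) (by omega) j hj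
  have h' := stepSum_add_natStepSum sieveWeights (72 * (t / 72) + j)
  rw [show (sieveWeights.filter (·.2 < 0)).map (fun w ↦ (w.1, w.2.natAbs)) = negSieveWeights by
      decide +kernel,
    show (sieveWeights.filter (0 ≤ ·.2)).map (fun w ↦ (w.1, w.2.natAbs)) = posSieveWeights by
      decide +kernel,
    stepSum_sieveWeights_congr (t := t) (by omega) (by omega) (by omega)] at h'
  split_ifs at h ⊢ <;> omega

lemma stepSum_sieveWeights_le (t : ℕ) :
    stepSum sieveWeights t ≤ (if t = 8 then 1 else 0) + (if 8720 ≤ t then 1 else 0) := by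
  have hper := stepSum_mul_add (P := 15120) (L := sieveWeights) (by decide +kernel)
    (t / 15120) (t % 15120)
  rw [Nat.div_add_mod, show stepSum sieveWeights 15120 = 0 by decide +kernel, zero_mul,
    zero_add] at hper
  have hr := stepSum_sieveWeights_le_of_lt (Nat.mod_lt t (by norm_num : 0 < 15120))
  rw [← hper] at hr
  refine hr.trans ?_
  split_ifs <;> omega

/-! ### Sums of logarithms of factorials -/

/-- The weighted sum of the numbers `log ⌊x / e⌋!`. -/
noncomputable def logFactorialSum (L : List (ℕ × ℤ)) (x : ℕ) : ℝ :=
  (L.map fun w ↦ (w.2 : ℝ) * log ((x / w.1)! : ℝ)).sum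

lemma logFactorialSum_eq_sum_vonMangoldt (L : List (ℕ × ℤ)) (x : ℕ) :
    logFactorialSum L x = ∑ m ∈ Ioc 0 x, Λ m * (stepSum L (x / m) : ℝ) := by
  induction L with
  | nil => simp [logFactorialSum, stepSum]
  | cons w L ih =>
    simp only [logFactorialSum, stepSum, List.map_cons, List.sum_cons] at ih ⊢
    rw [ih, log_factorial_div_eq_sum_vonMangoldt, Finset.mul_sum, ← Finset.sum_add_distrib]
    refine Finset.sum_congr rfl fun m _ ↦ ?_
    rw [Int.cast_add, Int.cast_mul, Int.cast_natCast]
    ring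

lemma logFactorialSum_sieveWeights_le (n : ℕ) :
    logFactorialSum sieveWeights (72 * n) ≤
      ψ ((9 * n : ℕ) : ℝ) - ψ ((8 * n : ℕ) : ℝ) + ψ ((72 * n / 8720 : ℕ) : ℝ) := by
  have hψ : ∀ y ≤ 72 * n, ψ (y : ℝ) = ∑ m ∈ Ioc 0 (72 * n), if m ≤ y then Λ m else 0 := by
    intro y hy
    rw [Chebyshev.psi, Nat.floor_natCast, ← Finset.sum_filter]
    congr 1
    ext m
    simp only [Finset.mem_filter, Finset.mem_Ioc]
    omega
  rw [logFactorialSum_eq_sum_vonMangoldt, hψ _ (by omega), hψ _ (by omega), hψ _ (by omega),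
    ← Finset.sum_sub_distrib, ← Finset.sum_add_distrib]
  refine Finset.sum_le_sum fun m hm ↦ ?_
  have hm₀ : 0 < m := (Finset.mem_Ioc.mp hm).1
  have h₈ : m ≤ 9 * n ↔ 8 ≤ 72 * n / m := by
    rw [Nat.le_div_iff_mul_le hm₀]; omega
  have h₉ : m ≤ 8 * n ↔ 9 ≤ 72 * n / m := by
    rw [Nat.le_div_iff_mul_le hm₀]; omega
  have hK : m ≤ 72 * n / 8720 ↔ 8720 ≤ 72 * n / m := by
    rw [Nat.le_div_iff_mul_le hm₀, Nat.le_div_iff_mul_le (by norm_num), mul_comm]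
  have hF : (stepSum sieveWeights (72 * n / m) : ℝ) ≤
      (if 72 * n / m = 8 then 1 else 0) + (if 8720 ≤ 72 * n / m then 1 else 0) := by
    exact_mod_cast stepSum_sieveWeights_le (72 * n / m)
  refine (mul_le_mul_of_nonneg_left hF vonMangoldt_nonneg).trans_eq ?_
  simp only [h₈, h₉, hK]
  split_ifs <;> first | omega | simp

lemma le_logFactorialSum {L : List (ℕ × ℤ)} {x : ℕ} (hL : ∀ w ∈ L, 0 < w.1 ∧ w.1 ≤ x) :
    (L.map fun w ↦ (w.2 : ℝ) / w.1).sum * (x * log x - x) -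
        x * (L.map fun w ↦ (w.2 : ℝ) / w.1 * log w.1).sum -
        ((L.map fun w ↦ |w.2|).sum : ℤ) * (log x + 1) ≤ logFactorialSum L x := by
  induction L with
  | nil => simp [logFactorialSum]
  | cons w L ih =>
    have ih := ih fun v hv ↦ hL v (List.mem_cons_of_mem _ hv)
    obtain ⟨hw, hwx⟩ := hL w List.mem_cons_self
    have h := abs_log_factorial_div_sub_le hw hwx
    have hw' : (0 : ℝ) < w.1 := by exact_mod_cast hw
    have hx' : (0 : ℝ) < x := by exact_mod_cast hw.trans_le hwx
    rw [Real.log_div hx'.ne' hw'.ne'] at h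
    have h' := mul_le_mul_of_nonneg_left h (abs_nonneg (w.2 : ℝ))
    rw [← abs_mul] at h'
    have h'' := (abs_le.mp h').1
    simp only [logFactorialSum, List.map_cons, List.sum_cons] at ih ⊢
    push_cast at ih ⊢
    have e : (w.2 : ℝ) * ((x : ℝ) / w.1 * (log x - log w.1) - (x : ℝ) / w.1) =
        (w.2 : ℝ) / w.1 * (x * log x - x) - x * ((w.2 : ℝ) / w.1 * log w.1) := by
      ring
    linarith

lemma log_two_pow_mul_three_pow_mul_five_pow_mul_seven_pow (i j k l : ℕ) :
    log ((2 ^ i * 3 ^ j * 5 ^ k * 7 ^ l : ℕ) : ℝ) =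
      i * log 2 + j * log 3 + k * log 5 + l * log 7 := by
  push_cast
  rw [Real.log_mul (by positivity) (by positivity), Real.log_mul (by positivity) (by positivity),
    Real.log_mul (by positivity) (by positivity)]
  simp only [Real.log_pow]

lemma log_seven_lt : log 7 < 1.94603 := by
  have h : log (7 ^ 4 : ℝ) = 5 * log 2 + log 3 + 2 * log 5 + log (2401 / 2400) := by
    rw [show (7 ^ 4 : ℝ) = 2 ^ 5 * 3 * 5 ^ 2 * (2401 / 2400) by norm_num,
      Real.log_mul (by positivity) (by positivity), Real.log_mul (by positivity) (by positivity),
      Real.log_mul (by positivity) (by positivity), Real.log_pow, Real.log_pow]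
    norm_num
  rw [Real.log_pow] at h
  have h' := Real.log_le_sub_one_of_pos (by norm_num : (0 : ℝ) < 2401 / 2400)
  norm_num at h h'
  linarith [Real.log_two_lt_d9, Real.log_three_lt_d9, Real.log_five_lt_d9]

lemma sieveWeights_sum_log_le :
    (sieveWeights.map fun w ↦ (w.2 : ℝ) / w.1 * log w.1).sum ≤ -0.37 / 72 := by
  rw [sieveWeights_eq_map, List.map_map]
  simp only [Function.comp_def, log_two_pow_mul_three_pow_mul_five_pow_mul_seven_pow]
  simp only [sieveExponents, List.map_cons, List.map_nil, List.sum_cons, List.sum_nil]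
  norm_num
  linarith [Real.log_two_lt_d9, Real.log_three_gt_d9, Real.log_five_lt_d9, log_seven_lt]

lemma sieveWeights_sum_inv : (sieveWeights.map fun w ↦ (w.2 : ℝ) / w.1).sum = 0 := by
  simp only [sieveWeights, List.map_cons, List.map_nil, List.sum_cons, List.sum_nil]
  norm_num

lemma le_logFactorialSum_sieveWeights {n : ℕ} (hn : 210 ≤ n) :
    0.37 * (n : ℝ) - 101 * (log (72 * n) + 1) ≤ logFactorialSum sieveWeights (72 * n) := by
  have hL : ∀ w ∈ sieveWeights, 0 < w.1 ∧ w.1 ≤ 72 * n := by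
    have : ∀ w ∈ sieveWeights, 0 < w.1 ∧ w.1 ≤ 72 * 210 := by decide +kernel
    intro w hw
    have := this w hw
    omega
  have h := le_logFactorialSum hL
  rw [sieveWeights_sum_inv,
    show (sieveWeights.map fun w ↦ |w.2|).sum = 101 by decide +kernel] at h
  push_cast at h
  have h' := mul_le_mul_of_nonneg_left sieveWeights_sum_log_le
    (by positivity : (0 : ℝ) ≤ 72 * n)
  linarith

/-! ### Large `n` -/

lemma log_le_sqrt_div_add {x : ℝ} (hx : 0 < x) : log x ≤ √x / 500 + 12 := by
  have h₁ := Real.log_le_sub_one_of_pos (by positivity : 0 < √x / 1000)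
  have h₂ : log (1000 : ℝ) ≤ 7 := by
    rw [show (1000 : ℝ) = 2 ^ 3 * 5 ^ 3 by norm_num,
      Real.log_mul (by positivity) (by positivity), Real.log_pow, Real.log_pow]
    norm_num
    linarith [Real.log_two_lt_d9, Real.log_five_lt_d9]
  rw [Real.log_div (by positivity) (by norm_num), Real.log_sqrt hx.le] at h₁
  linarith

lemma psi_sub_psi_le_of_forall_not_prime {a b : ℕ} (ha : 1 ≤ a) (hab : a ≤ b)
    (h : ∀ p, a < p → p ≤ b → ¬ p.Prime) : ψ (b : ℝ) - ψ (a : ℝ) ≤ 2 * √b * log b := by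
  have hθ : θ (b : ℝ) = θ (a : ℝ) := by
    rw [Chebyshev.theta, Chebyshev.theta, Nat.floor_natCast, Nat.floor_natCast]
    congr 1
    ext p
    simp only [Finset.mem_filter, Finset.mem_Ioc]
    constructor
    · rintro ⟨⟨h₁, h₂⟩, hp⟩
      exact ⟨⟨h₁, not_lt.mp fun h₃ ↦ h p h₃ h₂ hp⟩, hp⟩
    · rintro ⟨⟨h₁, h₂⟩, hp⟩
      exact ⟨⟨h₁, h₂.trans hab⟩, hp⟩
  have h₁ := Chebyshev.psi_sub_theta_le (x := b) (by exact_mod_cast ha.trans hab)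
  linarith [Chebyshev.theta_le_psi (a : ℝ)]

lemma exists_prime_of_million_le {n : ℕ} (hn : 1000000 ≤ n) :
    ∃ p : ℕ, p.Prime ∧ 8 * n < p ∧ p < 9 * n := by
  by_contra! hcon
  have hprime : ∀ p, 8 * n < p → p ≤ 9 * n → ¬ p.Prime := by
    intro p h₁ h₂ hp
    have h₃ : p = 9 * n := le_antisymm h₂ (hcon p hp h₁)
    exact Nat.not_prime_mul (by norm_num) (by omega) (h₃ ▸ hp)
  have hψ := psi_sub_psi_le_of_forall_not_prime (by omega) (by omega) hprime
  have hle := logFactorialSum_sieveWeights_le n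
  have hge := le_logFactorialSum_sieveWeights (n := n) (by omega)
  have hn' : (1000000 : ℝ) ≤ n := by exact_mod_cast hn
  have hy : ψ ((72 * n / 8720 : ℕ) : ℝ) ≤ ψ ((n : ℝ) / 100) := by
    refine Chebyshev.psi_mono ((Nat.cast_div_le).trans ?_)
    push_cast
    rw [div_le_div_iff₀ (by norm_num) (by norm_num)]
    linarith
  have hψy := Chebyshev.psi_le (x := (n : ℝ) / 100) (by linarith)
  have hlog4 : log (4 : ℝ) ≤ 1.4 := by
    rw [show (4 : ℝ) = 2 ^ 2 by norm_num, Real.log_pow]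
    norm_num
    linarith [Real.log_two_lt_d9]
  have hw := Real.sq_sqrt (by positivity : (0 : ℝ) ≤ n)
  have hw₀ : 1000 ≤ √(n : ℝ) := Real.le_sqrt_of_sq_le (by linarith)
  have hlog := log_le_sqrt_div_add (by positivity : (0 : ℝ) < n)
  have hlog72 : log (72 * (n : ℝ)) ≤ log n + 5 := by
    rw [Real.log_mul (by norm_num) (by positivity), show (72 : ℝ) = 2 ^ 3 * 3 ^ 2 by norm_num,
      Real.log_mul (by positivity) (by positivity), Real.log_pow, Real.log_pow]
    norm_num
    linarith [Real.log_two_lt_d9, Real.log_three_lt_d9]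
  have hlog9 : log (9 * (n : ℝ)) ≤ log n + 3 := by
    rw [Real.log_mul (by norm_num) (by positivity), show (9 : ℝ) = 3 ^ 2 by norm_num, Real.log_pow]
    norm_num
    linarith [Real.log_three_lt_d9]
  have hlogy : log ((n : ℝ) / 100) ≤ log n :=
    Real.log_le_log (by positivity) (div_le_self (by positivity) (by norm_num))
  have hsqrt9 : √(9 * (n : ℝ)) = 3 * √n := by
    rw [Real.sqrt_mul (by norm_num), show (9 : ℝ) = 3 ^ 2 by norm_num, Real.sqrt_sq (by norm_num)]
  have hsqrty : √((n : ℝ) / 100) = √n / 10 := by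
    rw [Real.sqrt_div (by positivity), show (100 : ℝ) = 10 ^ 2 by norm_num,
      Real.sqrt_sq (by norm_num)]
  push_cast at hψ hle hy
  rw [hsqrt9] at hψ
  rw [hsqrty] at hψy
  generalize √(n : ℝ) = w at *
  have h₁ : 2 * (3 * w) * log (9 * (n : ℝ)) ≤ 2 * (3 * w) * (w / 500 + 15) :=
    mul_le_mul_of_nonneg_left (by linarith) (by linarith)
  have h₂ : 2 * (w / 10) * log ((n : ℝ) / 100) ≤ 2 * (w / 10) * (w / 500 + 12) :=
    mul_le_mul_of_nonneg_left (by linarith) (by linarith)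
  have h₃ : log 4 * ((n : ℝ) / 100) ≤ 1.4 * ((n : ℝ) / 100) :=
    mul_le_mul_of_nonneg_right hlog4 (by linarith)
  nlinarith

/-! ### Small `n` -/

/-- A chain of primes `p` for which the intervals `(p / 9, p / 8)` cover `[5, 10 ^ 6]`. -/
def primeChain : List ℕ :=
  [43, 53, 61, 71, 79, 89, 107, 113, 131, 151, 167, 181, 199, 223, 251, 283, 317, 359, 401, 457,
    521, 593, 673, 761, 863, 971, 1097, 1237, 1381, 1553, 1753, 1979, 2221, 2477, 2789, 3137,
    3533, 3967, 4463, 5021, 5651, 6361, 7159, 8053, 9059, 10193, 11471, 12899, 14503, 16301,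
    18341, 20627, 23209, 26113, 29383, 33053, 37181, 41813, 47041, 52919, 59513, 66959, 75329,
    84751, 95339, 107251, 120661, 135743, 152681, 171763, 193201, 217351, 244507, 275059, 309437,
    348097, 391613, 440567, 495637, 557591, 627271, 705643, 793853, 893059, 1004687, 1130273,
    1271561, 1430503, 1609301, 1810451, 2036747, 2291327, 2577739, 2899943, 3262429, 3670231,
    4129007, 4645117, 5225743, 5878927, 6613781, 7440491, 8370553]

lemma prime_of_mem_primeChain : ∀ p ∈ primeChain, p.Prime := by
  simp only [primeChain, List.forall_mem_cons, List.not_mem_nil, IsEmpty.forall_iff, implies_true,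
    and_true]
  norm_num

/-- Whether the intervals `(p / 9, p / 8)`, for `p` in a list, successively cover the integers
from `a` up to but excluding `b`. -/
def coversFrom (a b : ℕ) : List ℕ → Bool
  | [] => decide (b ≤ a)
  | p :: L => decide (p < 9 * a) && coversFrom ((p - 1) / 8 + 1) b L

lemma exists_mem_of_coversFrom {a b n : ℕ} {L : List ℕ} (h : coversFrom a b L = true)
    (han : a ≤ n) (hnb : n < b) : ∃ p ∈ L, 8 * n < p ∧ p < 9 * n := by
  induction L generalizing a with
  | nil =>
    simp only [coversFrom, decide_eq_true_eq] at h
    omega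
  | cons p L ih =>
    simp only [coversFrom, Bool.and_eq_true, decide_eq_true_eq] at h
    by_cases hp : 8 * n < p
    · exact ⟨p, List.mem_cons_self, hp, by omega⟩
    · obtain ⟨q, hq, hqn⟩ := ih h.2 (by omega)
      exact ⟨q, List.mem_cons_of_mem _ hq, hqn⟩

theorem stmt_2 (n : ℕ) (hn : 4 < n) : ∃ p : ℕ, p.Prime ∧ 8 * n < p ∧ p < 9 * n := by
  rcases lt_or_ge n 1000000 with h | h
  · obtain ⟨p, hp, hpn⟩ := exists_mem_of_coversFrom (a := 5) (b := 1000000) (L := primeChain)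
      (by decide +kernel) hn h
    exact ⟨p, prime_of_mem_primeChain p hp, hpn⟩
  · exact exists_prime_of_million_le h
end

section
/- For every positive integer n > 4 there exists a prime number p satisfying 6n < p < 7n. -/
open Finset Real Chebyshev
open ArithmeticFunction hiding log id
open scoped Nat

namespace PrimeSixSeven

/-! ### Stirling's formula for the factorial of a floor -/

theorem log_factorial_le {m : ℕ} (hm : m ≠ 0) :
    log m ! ≤ m * log m - m + log m / 2 + 1 := by
  obtain ⟨k, rfl⟩ := Nat.exists_eq_succ_of_ne_zero hm
  have h : Stirling.stirlingSeq (k + 1) ≤ Stirling.stirlingSeq 1 :=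
    Stirling.stirlingSeq'_antitone (Nat.zero_le k)
  have h' := log_le_log (Stirling.stirlingSeq'_pos k) h
  have hk : ((k + 1 : ℕ) : ℝ) ≠ 0 := by positivity
  rw [Stirling.log_stirlingSeq_formula, Stirling.log_stirlingSeq_formula,
    log_div hk (exp_pos 1).ne', log_mul two_ne_zero hk] at h'
  simp only [log_exp, Nat.factorial_one, Nat.cast_one, log_one, mul_one, one_div, log_inv] at h'
  rw [Nat.succ_eq_add_one]
  linarith

theorem abs_log_factorial_floor_sub_le {y : ℝ} (hy : 1 ≤ y) :
    |log ⌊y⌋₊ ! - (y * log y - y)| ≤ log y + 1 := by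
  have hm1 : 1 ≤ ⌊y⌋₊ := (Nat.one_le_floor_iff y).2 hy
  have hle : (⌊y⌋₊ : ℝ) ≤ y := Nat.floor_le (by linarith)
  have hlt : y < ⌊y⌋₊ + 1 := Nat.lt_floor_add_one y
  have hlow := Stirling.le_log_factorial_stirling (n := ⌊y⌋₊) (by lia)
  have hupp := log_factorial_le (m := ⌊y⌋₊) (by lia)
  generalize ⌊y⌋₊ = m at *
  have hm : (1 : ℝ) ≤ m := by exact_mod_cast hm1
  have hm0 : (0 : ℝ) < m := by linarith
  have hy0 : 0 < y := by linarith
  have hlogm : 0 ≤ log m := log_nonneg hm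
  have hlogy : log m ≤ log y := log_le_log hm0 hle
  have hpi : 0 ≤ log (2 * π) := log_nonneg (by linarith [pi_gt_three])
  have h1 : m - y ≤ m * (log m - log y) := by
    have := one_sub_inv_le_log_of_pos (div_pos hm0 hy0)
    rw [log_div hm0.ne' hy0.ne', inv_div] at this
    have := mul_le_mul_of_nonneg_left this hm0.le
    rwa [mul_sub, mul_one, mul_div_cancel₀ _ hm0.ne'] at this
  have h2 : y - m ≤ y * (log y - log m) := by
    have := one_sub_inv_le_log_of_pos (div_pos hy0 hm0)
    rw [log_div hy0.ne' hm0.ne', inv_div] at this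
    have := mul_le_mul_of_nonneg_left this hy0.le
    rwa [mul_sub, mul_one, mul_div_cancel₀ _ hy0.ne'] at this
  rw [abs_le]
  constructor
  · nlinarith [mul_nonneg (sub_nonneg.2 hlt.le) (hlogm.trans hlogy)]
  · nlinarith [mul_nonneg (sub_nonneg.2 hle) hlogm]

/-! ### Weighted sums of logarithms of factorials -/

theorem log_factorial_eq_sum_vonMangoldt {m M : ℕ} (h : m ≤ M) :
    log m ! = ∑ n ∈ Ioc 0 M, Λ n * ((m / n : ℕ) : ℝ) := by
  have h1 : log m ! = ∑ n ∈ Ioc 0 m, Λ n * ((m / n : ℕ) : ℝ) := by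
    have hIoc : Ioc 0 m = Ico 1 (m + 1) := by
      ext n
      simp only [mem_Ioc, mem_Ico]
      lia
    rw [← sum_Ioc_mul_zeta_eq_sum, vonMangoldt_mul_zeta, hIoc, ← prod_Ico_id_eq_factorial,
      Nat.cast_prod, log_prod]
    · simp only [log_apply]
    · intro i hi
      have := (mem_Ico.1 hi).1
      positivity
  rw [h1]
  refine sum_subset (Ioc_subset_Ioc_right h) fun n hn hn' ↦ ?_
  have : m < n := by
    simp only [mem_Ioc] at hn hn'
    lia
  simp [Nat.div_eq_of_lt this]

/-- For a list of pairs `(k, c)`, the sum of `c * ⌊w / k⌋`. -/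
def weightedFloor (l : List (ℕ × ℤ)) (w : ℕ) : ℤ :=
  (l.map fun a ↦ a.2 * ((w / a.1 : ℕ) : ℤ)).sum

theorem sum_weighted_log_factorial (l : List (ℕ × ℤ)) (X : ℕ) :
    (l.map fun a ↦ (a.2 : ℝ) * log (X / a.1)!).sum =
      ∑ n ∈ Ioc 0 X, Λ n * (weightedFloor l (X / n) : ℝ) := by
  induction l with
  | nil => simp [weightedFloor]
  | cons a l ih =>
    rw [List.map_cons, List.sum_cons, ih, log_factorial_eq_sum_vonMangoldt (Nat.div_le_self X a.1),
      mul_sum, ← sum_add_distrib]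
    refine sum_congr rfl fun n _ ↦ ?_
    rw [weightedFloor, weightedFloor, List.map_cons, List.sum_cons, Nat.div_div_eq_div_mul,
      mul_comm a.1, ← Nat.div_div_eq_div_mul]
    simp only [Int.cast_add, Int.cast_mul, Int.cast_natCast]
    ring

theorem weightedFloor_add (l : List (ℕ × ℤ)) {P : ℕ} (hl : ∀ a ∈ l, a.1 ∣ P) (w : ℕ) :
    weightedFloor l (w + P) = weightedFloor l w + weightedFloor l P := by
  induction l with
  | nil => simp [weightedFloor]
  | cons a l ih =>
    have ih := ih fun b hb ↦ hl b (List.mem_cons_of_mem _ hb)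
    have hP := hl a List.mem_cons_self
    simp only [weightedFloor, List.map_cons, List.sum_cons] at ih ⊢
    rw [ih, Nat.add_div_of_dvd_left hP, Nat.cast_add]
    ring

theorem weighted_stirling_le (l : List (ℕ × ℤ)) (X : ℕ) (hl : ∀ a ∈ l, 6 ≤ a.1 ∧ a.1 ≤ X) :
    (l.map fun a ↦ (a.2 : ℝ) * (X / a.1 * (log X - log a.1 - 1))).sum -
        (l.map fun a ↦ |(a.2 : ℝ)|).sum * log X ≤
      (l.map fun a ↦ (a.2 : ℝ) * log (X / a.1)!).sum := by
  induction l with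
  | nil => simp
  | cons a l ih =>
    have ih := ih fun b hb ↦ hl b (List.mem_cons_of_mem _ hb)
    obtain ⟨h6, hX⟩ := hl a List.mem_cons_self
    simp only [List.map_cons, List.sum_cons]
    have ha : (6 : ℝ) ≤ a.1 := by exact_mod_cast h6
    have haX : (a.1 : ℝ) ≤ X := by exact_mod_cast hX
    have ha0 : (0 : ℝ) < a.1 := by linarith
    have hX0 : (0 : ℝ) < X := by linarith
    have hlog : 1 ≤ log a.1 := by
      rw [le_log_iff_exp_le ha0]
      linarith [exp_one_lt_three]
    have h := abs_log_factorial_floor_sub_le (y := X / a.1) ((one_le_div ha0).2 haX)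
    rw [Nat.floor_div_eq_div, log_div hX0.ne' ha0.ne'] at h
    have h' : |(a.2 : ℝ) * (log (X / a.1)! - (X / a.1 * (log X - log a.1) - X / a.1))| ≤
        |(a.2 : ℝ)| * log X := by
      rw [abs_mul]
      exact mul_le_mul_of_nonneg_left (by linarith) (abs_nonneg _)
    have := (abs_le.1 h').1
    linarith

/-! ### The weights -/

/-- Weights whose weighted floor sum is at most `1` on `{6} ∪ [66, ∞)` and at most `0`
elsewhere. -/
def weights : List (ℕ × ℤ) :=
  [(6, 1), (7, -1), (12, -1), (14, 1), (18, -1), (21, 1), (30, -1), (35, 1), (36, 1), (42, -2),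
   (60, 2), (70, -1), (84, 1), (90, 1), (105, -2), (126, 1), (168, -1), (180, -2), (210, 2),
   (252, -2), (315, 1), (360, 1), (420, -2), (504, 2), (630, -2), (840, 1), (1260, 2), (2520, 1)]

theorem weightedFloor_weights_add (w : ℕ) :
    weightedFloor weights (w + 2520) = weightedFloor weights w := by
  have h : weightedFloor weights 2520 = 0 := by decide +kernel
  rw [weightedFloor_add weights (by decide +kernel), h, add_zero]

theorem weightedFloor_weights_le_one (w : ℕ) : weightedFloor weights w ≤ 1 := by
  induction w using Nat.strong_induction_on with
  | _ w ih =>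
    rcases lt_or_ge w 2520 with h | h
    · have : ∀ r < 2520, weightedFloor weights r ≤ 1 := by decide +kernel
      exact this w h
    · obtain ⟨v, rfl⟩ := Nat.exists_eq_add_of_le' h
      rw [weightedFloor_weights_add]
      exact ih v (by lia)

theorem weightedFloor_weights_le (w : ℕ) :
    weightedFloor weights w ≤
      (if 6 ≤ w then 1 else 0) - (if 7 ≤ w then 1 else 0) + (if 66 ≤ w then 1 else 0) := by
  rcases lt_or_ge w 66 with h | h
  · have : ∀ r < 66, weightedFloor weights r ≤
        (if 6 ≤ r then 1 else 0) - (if 7 ≤ r then 1 else 0) + (if 66 ≤ r then 1 else 0) := by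
      decide +kernel
    exact this w h
  · have := weightedFloor_weights_le_one w
    split_ifs <;> lia

theorem psi_natCast_div_eq_sum (X : ℕ) {k : ℕ} (hk : 0 < k) :
    ψ ((X / k : ℕ) : ℝ) = ∑ n ∈ Ioc 0 X, Λ n * (if k ≤ X / n then 1 else 0 : ℝ) := by
  simp only [mul_ite, mul_one, mul_zero]
  rw [psi, Nat.floor_natCast, ← sum_filter]
  refine sum_congr ?_ fun _ _ ↦ rfl
  ext n
  simp only [mem_filter, mem_Ioc]
  constructor
  · rintro ⟨h0, h⟩
    refine ⟨⟨h0, h.trans (Nat.div_le_self X k)⟩, ?_⟩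
    rw [Nat.le_div_iff_mul_le h0, mul_comm]
    rwa [Nat.le_div_iff_mul_le hk] at h
  · rintro ⟨⟨h0, -⟩, h⟩
    refine ⟨h0, ?_⟩
    rw [Nat.le_div_iff_mul_le hk, mul_comm]
    rwa [Nat.le_div_iff_mul_le h0] at h

theorem weighted_log_factorial_le_psi (X : ℕ) :
    (weights.map fun a ↦ (a.2 : ℝ) * log (X / a.1)!).sum ≤
      ψ ((X / 6 : ℕ) : ℝ) - ψ ((X / 7 : ℕ) : ℝ) + ψ ((X / 66 : ℕ) : ℝ) := by
  rw [sum_weighted_log_factorial, psi_natCast_div_eq_sum X (by norm_num : 0 < 6),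
    psi_natCast_div_eq_sum X (by norm_num : 0 < 7), psi_natCast_div_eq_sum X (by norm_num : 0 < 66),
    ← sum_sub_distrib, ← sum_add_distrib]
  refine sum_le_sum fun n _ ↦ ?_
  rw [← mul_sub, ← mul_add]
  refine mul_le_mul_of_nonneg_left ?_ vonMangoldt_nonneg
  exact_mod_cast weightedFloor_weights_le (X / n)

theorem log_smooth {k : ℝ} (a b c d : ℕ) (hk : k = 2 ^ a * 3 ^ b * 5 ^ c * 7 ^ d) :
    log k = a * log 2 + b * log 3 + c * log 5 + d * log 7 := by
  rw [hk, log_mul (by positivity) (by positivity), log_mul (by positivity) (by positivity),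
    log_mul (by positivity) (by positivity), log_pow, log_pow, log_pow, log_pow]

theorem weights_main_term (X L : ℝ) :
    (weights.map fun a ↦ (a.2 : ℝ) * (X / a.1 * (L - log a.1 - 1))).sum =
      X / 2520 * (147 * log 7 - 138 * log 2 - 96 * log 3 - 15 * log 5) := by
  simp only [weights, List.map_cons, List.map_nil, List.sum_cons, List.sum_nil, Nat.cast_ofNat]
  rw [log_smooth (k := 6) 1 1 0 0 (by norm_num),
    log_smooth (k := 12) 2 1 0 0 (by norm_num),
    log_smooth (k := 14) 1 0 0 1 (by norm_num),
    log_smooth (k := 18) 1 2 0 0 (by norm_num),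
    log_smooth (k := 21) 0 1 0 1 (by norm_num),
    log_smooth (k := 30) 1 1 1 0 (by norm_num),
    log_smooth (k := 35) 0 0 1 1 (by norm_num),
    log_smooth (k := 36) 2 2 0 0 (by norm_num),
    log_smooth (k := 42) 1 1 0 1 (by norm_num),
    log_smooth (k := 60) 2 1 1 0 (by norm_num),
    log_smooth (k := 70) 1 0 1 1 (by norm_num),
    log_smooth (k := 84) 2 1 0 1 (by norm_num),
    log_smooth (k := 90) 1 2 1 0 (by norm_num),
    log_smooth (k := 105) 0 1 1 1 (by norm_num),
    log_smooth (k := 126) 1 2 0 1 (by norm_num),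
    log_smooth (k := 168) 3 1 0 1 (by norm_num),
    log_smooth (k := 180) 2 2 1 0 (by norm_num),
    log_smooth (k := 210) 1 1 1 1 (by norm_num),
    log_smooth (k := 252) 2 2 0 1 (by norm_num),
    log_smooth (k := 315) 0 2 1 1 (by norm_num),
    log_smooth (k := 360) 3 2 1 0 (by norm_num),
    log_smooth (k := 420) 2 1 1 1 (by norm_num),
    log_smooth (k := 504) 3 2 0 1 (by norm_num),
    log_smooth (k := 630) 1 2 1 1 (by norm_num),
    log_smooth (k := 840) 3 1 1 1 (by norm_num),
    log_smooth (k := 1260) 2 2 1 1 (by norm_num),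
    log_smooth (k := 2520) 3 2 1 1 (by norm_num)]
  push_cast
  ring

theorem weights_abs_sum : (weights.map fun a ↦ |(a.2 : ℝ)|).sum = 38 := by
  simp only [weights, List.map_cons, List.map_nil, List.sum_cons, List.sum_nil]
  norm_num

theorem log_seven_lower_bound :
    225 * log 2 + 96 * log 3 + 15 * log 5 ≤ 147 * log 7 := by
  have h : log ((2 : ℝ) ^ 225 * 3 ^ 96 * 5 ^ 15 * 7 ^ 0) ≤ log (2 ^ 0 * 3 ^ 0 * 5 ^ 0 * 7 ^ 147) :=
    log_le_log (by positivity) (by norm_num)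
  rw [log_smooth 225 96 15 0 rfl, log_smooth 0 0 0 147 rfl] at h
  push_cast at h
  linarith

/-! ### Large `n` -/

theorem psi_sub_psi_ge {n : ℕ} (hn : 60 ≤ n) :
    87 / 60 * log 2 * n - 38 * log (42 * n) - ψ (7 * n / 11) ≤ ψ (7 * n) - ψ (6 * n) := by
  have hX : ∀ a ∈ weights, 6 ≤ a.1 ∧ a.1 ≤ 42 * n := by
    have : ∀ a ∈ weights, 6 ≤ a.1 ∧ a.1 ≤ 2520 := by decide +kernel
    intro a ha
    have := this a ha
    lia
  have h := (weighted_stirling_le weights (42 * n) hX).trans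
    (weighted_log_factorial_le_psi (42 * n))
  rw [weights_main_term, weights_abs_sum, show 42 * n / 6 = 7 * n by lia,
    show 42 * n / 7 = 6 * n by lia] at h
  have h66 : ψ ((42 * n / 66 : ℕ) : ℝ) ≤ ψ (7 * n / 11) := by
    refine psi_mono (Nat.cast_div_le.trans (le_of_eq ?_))
    push_cast
    ring
  push_cast at h
  have hn0 : (0 : ℝ) ≤ n := n.cast_nonneg
  nlinarith [mul_le_mul_of_nonneg_left log_seven_lower_bound hn0]

theorem log_le_of_four_million_le {x : ℝ} (hx : 4000000 ≤ x) :
    log (42 * x) ≤ 17 + √x / 1000 := by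
  have h19 : (168000000 : ℝ) ≤ exp 19 := by
    have h1 : (2.7182818283 : ℝ) ^ 19 ≤ exp 1 ^ 19 :=
      pow_le_pow_left₀ (by norm_num) exp_one_gt_d9.le 19
    rw [← exp_nat_mul] at h1
    norm_num at h1 ⊢
    linarith
  have hlog : log 168000000 ≤ 19 := (log_le_iff_le_exp (by norm_num)).2 h19
  have hs : 0 < √x := sqrt_pos.2 (by linarith)
  have h2 : log (√x / 2000) ≤ √x / 2000 - 1 := log_le_sub_one_of_pos (by positivity)
  have h3 : 42 * x = 168000000 * (√x / 2000) ^ 2 := by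
    rw [div_pow, sq_sqrt (by linarith)]
    ring
  rw [h3, log_mul (by norm_num) (by positivity), log_pow]
  push_cast
  linarith

theorem exists_prime_of_four_million_le {n : ℕ} (hn : 4000000 ≤ n) :
    ∃ p : ℕ, p.Prime ∧ 6 * n < p ∧ p < 7 * n := by
  by_contra! hno
  have hθ : θ (7 * n) = θ (6 * n) := by
    have h7 : ⌊(7 * n : ℝ)⌋₊ = 7 * n := by exact_mod_cast Nat.floor_natCast (R := ℝ) (7 * n)
    have h6 : ⌊(6 * n : ℝ)⌋₊ = 6 * n := by exact_mod_cast Nat.floor_natCast (R := ℝ) (6 * n)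
    rw [theta, theta, h7, h6]
    refine sum_congr ?_ fun _ _ ↦ rfl
    ext p
    simp only [mem_filter, mem_Ioc]
    refine ⟨fun ⟨⟨h0, h⟩, hp⟩ ↦ ⟨⟨h0, ?_⟩, hp⟩, fun ⟨⟨h0, h⟩, hp⟩ ↦ ⟨⟨h0, by lia⟩, hp⟩⟩
    by_contra! hlt
    obtain rfl : p = 7 * n := le_antisymm h (hno p hp hlt)
    exact Nat.not_prime_mul (by norm_num) (by lia) hp
  have hx : (4000000 : ℝ) ≤ n := by exact_mod_cast hn
  have hmain := psi_sub_psi_ge (n := n) (by lia)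
  have h7 := psi_sub_theta_le (x := 7 * n) (by linarith)
  have h6 := theta_le_psi (6 * n)
  have h11 := psi_le (x := 7 * n / 11) (by linarith)
  have hlog := log_le_of_four_million_le hx
  generalize (n : ℝ) = x at *
  have hx0 : 0 < x := by linarith
  have hl7 : log (7 * x) ≤ log (42 * x) := log_le_log (by linarith) (by linarith)
  have hl11 : log (7 * x / 11) ≤ log (42 * x) := log_le_log (by linarith) (by linarith)
  have hs : 2000 ≤ √x := le_sqrt_of_sq_le (by linarith)
  have hsq : √x * √x = x := mul_self_sqrt hx0.le
  have hs7 : √(7 * x) ≤ 2.65 * √x := by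
    rw [sqrt_le_left (by positivity)]
    nlinarith
  have hs11 : √(7 * x / 11) ≤ 0.8 * √x := by
    rw [sqrt_le_left (by positivity)]
    nlinarith
  have h4 : log 4 = 2 * log 2 := by
    rw [show (4 : ℝ) = 2 ^ 2 by norm_num, log_pow]
    norm_num
  have hL : 0 ≤ 17 + √x / 1000 := by positivity
  have e7 : √(7 * x) * log (7 * x) ≤ 2.65 * √x * (17 + √x / 1000) :=
    mul_le_mul hs7 (hl7.trans hlog) (log_nonneg (by linarith)) (by positivity)
  have e11 : √(7 * x / 11) * log (7 * x / 11) ≤ 0.8 * √x * (17 + √x / 1000) :=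
    mul_le_mul hs11 (hl11.trans hlog) (log_nonneg (by linarith)) (by positivity)
  rw [h4] at h11
  have h2 : 0.6931 * x ≤ log 2 * x :=
    mul_le_mul_of_nonneg_right (by linarith [log_two_gt_d9]) hx0.le
  nlinarith

/-! ### Small `n` -/

theorem exists_mem_of_isChain {n : ℕ} (l : List ℕ) (a : ℕ)
    (hl : (a :: l).IsChain fun p q ↦ q < 7 * ((p + 5) / 6)) (ha : a < 7 * n)
    (hn : ∃ p ∈ a :: l, 6 * n < p) : ∃ p ∈ a :: l, 6 * n < p ∧ p < 7 * n := by
  induction l generalizing a with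
  | nil =>
    obtain ⟨p, hp, h⟩ := hn
    rw [List.mem_singleton] at hp
    subst hp
    exact ⟨p, List.mem_singleton_self p, h, ha⟩
  | cons b l ih =>
    rcases lt_or_ge (6 * n) a with h | h
    · exact ⟨a, List.mem_cons_self, h, ha⟩
    · rw [List.isChain_cons_cons] at hl
      obtain ⟨p, hp, hpn⟩ := hn
      have hp' : p ∈ b :: l := (List.mem_cons.1 hp).resolve_left (by lia)
      obtain ⟨q, hq, hqn⟩ := ih b hl.2 (by lia) ⟨p, hp', hpn⟩
      exact ⟨q, List.mem_cons_of_mem _ hq, hqn⟩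

/-- A chain of primes with consecutive ratios less than `7 / 6`. -/
def primeChain : List ℕ :=
  [31, 41, 47, 53, 61, 73, 89, 103, 113, 131, 151, 181, 211, 251, 293, 337, 397, 467, 541, 631,
   739, 863, 997, 1163, 1327, 1553, 1811, 2113, 2467, 2879, 3359, 3919, 4567, 5333, 6221, 7253,
   8461, 9871, 11519, 13421, 15649, 18257, 21283, 24821, 28949, 33773, 39397, 45959, 53617,
   62549, 72973, 85133, 99317, 115861, 135173, 157679, 183959, 214607, 250361, 292081, 340757,
   397549, 463807, 541097, 631273, 736471, 859213, 1002403, 1169473, 1364381, 1591753, 1857049,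
   2166557, 2527643, 2948917, 3440399, 4013783, 4682737, 5463197, 6373709, 7435979, 8675309,
   10121183, 11808031, 13776031, 16072039, 18750713, 21875827, 25521761]

theorem prime_of_mem_primeChain : ∀ p ∈ primeChain, p.Prime := by
  simp only [primeChain, List.forall_mem_cons]
  norm_num

theorem exists_prime_of_lt_four_million {n : ℕ} (hn : 4 < n) (hn' : n < 4000000) :
    ∃ p : ℕ, p.Prime ∧ 6 * n < p ∧ p < 7 * n := by
  obtain ⟨p, hp, h⟩ := exists_mem_of_isChain (n := n) primeChain.tail 31 (by decide +kernel)
    (by lia) ⟨25521761, by decide +kernel, by lia⟩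
  exact ⟨p, prime_of_mem_primeChain p hp, h⟩

end PrimeSixSeven

theorem stmt_5 (n : ℕ) (hn : 4 < n) : ∃ p : ℕ, p.Prime ∧ 6 * n < p ∧ p < 7 * n := by
  rcases lt_or_ge n 4000000 with h | h
  · exact PrimeSixSeven.exists_prime_of_lt_four_million hn h
  · exact PrimeSixSeven.exists_prime_of_four_million_le h
end

section
/- For every positive integer n > 5 there are at least seven prime numbers p satisfying n < p < 5n. -/
/-- The primes in `(n, m]` number at least `(θ m - θ n) / log m`. -/
theorem theta_sub_theta_le_card_mul_log {n m : ℕ} (h : n ≤ m) :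
    Chebyshev.theta m - Chebyshev.theta n ≤
      ((Finset.Ioc n m).filter Nat.Prime).card * Real.log m := by
  have hsplit : Chebyshev.theta m =
      Chebyshev.theta n + ∑ p ∈ (Finset.Ioc n m).filter Nat.Prime, Real.log p := by
    simp only [Chebyshev.theta, Nat.floor_natCast, Finset.sum_filter]
    exact (Finset.sum_Ioc_consecutive _ (Nat.zero_le n) h).symm
  rw [hsplit, add_sub_cancel_left, ← nsmul_eq_mul]
  refine Finset.sum_le_card_nsmul _ _ _ fun p hp => ?_
  simp only [Finset.mem_filter, Finset.mem_Ioc] at hp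
  exact Real.log_le_log (by exact_mod_cast hp.2.pos) (by exact_mod_cast hp.1.2)

/-- The main terms of the Chebyshev bounds on `(x / 5, x]` beat the error terms for large `x`. -/
theorem log_error_terms_lt {x : ℝ} (hx : 5000 ≤ x) :
    Real.log (x + 1) + 2 * √x * Real.log x + 6 * Real.log x < 3 / 5 * x * Real.log 2 := by
  have hx0 : 0 < x := by linarith
  have hs : 70 ≤ √x := Real.le_sqrt_of_sq_le (by linarith)
  have hsq : √x ^ 2 = x := Real.sq_sqrt hx0.le
  set s := √x
  have hlog_succ : Real.log (x + 1) ≤ 2 * Real.log x := by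
    rw [← Real.log_rpow hx0]
    exact Real.log_le_log (by linarith) (by norm_num; nlinarith)
  have hlog : Real.log x ≤ 6.4 + s / 32 := by
    have h : Real.log (s / 64) ≤ s / 64 - 1 :=
      Real.log_le_sub_one_of_pos (by positivity)
    rw [Real.log_div (by positivity) (by norm_num), show (64 : ℝ) = 2 ^ 6 by norm_num,
      Real.log_pow] at h
    rw [← hsq, Real.log_pow]
    push_cast at h ⊢
    linarith [Real.log_two_lt_d9]
  have hmain := mul_le_mul_of_nonneg_left hlog (by linarith : 0 ≤ 2 * s + 8)
  have htwo := mul_lt_mul_of_pos_left Real.log_two_gt_d9 (by positivity : 0 < 3 / 5 * x)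
  nlinarith

theorem seven_le_card_primes_Ioo_of_large {n : ℕ} (hn : 1000 ≤ n) :
    7 ≤ ((Finset.Ioo n (5 * n)).filter Nat.Prime).card := by
  have hIoc : (Finset.Ioo n (5 * n)).filter Nat.Prime =
      (Finset.Ioc n (5 * n)).filter Nat.Prime := by
    ext p
    simp only [Finset.mem_filter, Finset.mem_Ioo, Finset.mem_Ioc, and_congr_left_iff]
    intro hp
    have hne : p ≠ 5 * n := by
      rintro rfl
      exact Nat.not_prime_mul (by norm_num) (by omega) hp
    omega
  rw [hIoc]
  by_contra! hlt
  have hx : (5000 : ℝ) ≤ (5 * n : ℕ) := by exact_mod_cast (by omega : 5000 ≤ 5 * n)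
  have hcard := theta_sub_theta_le_card_mul_log (by omega : n ≤ 5 * n)
  have hlower := Chebyshev.theta_ge (5 * n)
  have hupper := Chebyshev.theta_le_log4_mul_x (Nat.cast_nonneg (α := ℝ) n)
  have hlog4 : Real.log 4 = 2 * Real.log 2 := by
    rw [show (4 : ℝ) = 2 ^ 2 by norm_num, Real.log_pow]; norm_num
  have herror := log_error_terms_lt hx
  have hsix : (((Finset.Ioc n (5 * n)).filter Nat.Prime).card : ℝ) * Real.log (5 * n : ℕ) ≤
      6 * Real.log (5 * n : ℕ) :=
    mul_le_mul_of_nonneg_right (by exact_mod_cast Nat.le_of_lt_succ hlt)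
      (Real.log_nonneg (by linarith))
  rw [hlog4] at hupper
  have hcast : ((5 * n : ℕ) : ℝ) * Real.log 2 = 5 * (n * Real.log 2) := by push_cast; ring
  linarith

theorem card_le_card_primes_Ioo {a b : ℕ} (s : Finset ℕ)
    (hprime : ∀ p ∈ s, p.Prime) (hlt : ∀ p ∈ s, a < p ∧ p < b) :
    s.card ≤ ((Finset.Ioo a b).filter Nat.Prime).card :=
  Finset.card_le_card fun p hp =>
    Finset.mem_filter.2 ⟨Finset.mem_Ioo.2 (hlt p hp), hprime p hp⟩

theorem stmt_13 (n : ℕ) (hn : 5 < n) :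
    7 ≤ ((Finset.Ioo n (5 * n)).filter Nat.Prime).card := by
  rcases le_or_gt 1000 n with h | h
  · exact seven_le_card_primes_Ioo_of_large h
  obtain ⟨s, hs, hprime, hlt⟩ : ∃ s : Finset ℕ, s.card = 7 ∧ (∀ p ∈ s, p.Prime) ∧
      ∀ p ∈ s, n < p ∧ p < 5 * n := by
    rcases lt_or_ge n 7 with h | h
    · exact ⟨{7, 11, 13, 17, 19, 23, 29}, rfl, by norm_num, by simp; omega⟩
    rcases lt_or_ge n 11 with h | h
    · exact ⟨{11, 13, 17, 19, 23, 29, 31}, rfl, by norm_num, by simp; omega⟩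
    rcases lt_or_ge n 17 with h | h
    · exact ⟨{17, 19, 23, 29, 31, 37, 41}, rfl, by norm_num, by simp; omega⟩
    rcases lt_or_ge n 59 with h | h
    · exact ⟨{59, 61, 67, 71, 73, 79, 83}, rfl, by norm_num, by simp; omega⟩
    rcases lt_or_ge n 263 with h | h
    · exact ⟨{263, 269, 271, 277, 281, 283, 293}, rfl, by norm_num, by simp; omega⟩
    · exact ⟨{1009, 1013, 1019, 1021, 1031, 1033, 1039}, rfl, by norm_num, by simp; omega⟩
  exact hs ▸ card_le_card_primes_Ioo s hprime hlt
end

section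
/- For every positive integer n > 8 there are at least eighteen prime numbers p satisfying n < p < 9n. -/
theorem filter_prime_Ioc_nine_mul (n : ℕ) :
    (Finset.Ioc n (9 * n)).filter Nat.Prime = (Finset.Ioo n (9 * n)).filter Nat.Prime := by
  ext p
  simp only [Finset.mem_filter, Finset.mem_Ioc, Finset.mem_Ioo]
  refine ⟨fun ⟨⟨h₁, h₂⟩, hp⟩ ↦ ⟨⟨h₁, h₂.lt_of_ne ?_⟩, hp⟩, fun ⟨⟨h₁, h₂⟩, hp⟩ ↦ ⟨⟨h₁, h₂.le⟩, hp⟩⟩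
  rintro rfl
  rw [show 9 * n = 3 * (3 * n) by ring] at hp
  exact Nat.not_prime_mul (by norm_num) (by omega) hp

theorem card_filter_prime_Icc_le {n a b : ℕ} (ha : n < a) (hb : b < 9 * n) :
    ((Finset.Icc a b).filter Nat.Prime).card ≤
      ((Finset.Ioo n (9 * n)).filter Nat.Prime).card := by
  refine Finset.card_le_card (Finset.filter_subset_filter _ fun p hp ↦ ?_)
  simp only [Finset.mem_Icc, Finset.mem_Ioo] at hp ⊢
  omega

theorem eighteen_le_card_of_large {n : ℕ} (hn : 601 ≤ n) :
    18 ≤ ((Finset.Ioo n (9 * n)).filter Nat.Prime).card := by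
  by_contra! hlt
  have hn' : (601 : ℝ) ≤ n := mod_cast hn
  have hcard := theta_sub_theta_le_card_mul_log (show n ≤ 9 * n by omega)
  rw [filter_prime_Ioc_nine_mul] at hcard
  have hlower := Chebyshev.theta_ge (9 * n)
  have hupper := Chebyshev.theta_le_log4_mul_x (Nat.cast_nonneg (α := ℝ) n)
  have hfour : Real.log 4 = 2 * Real.log 2 := by
    rw [show (4 : ℝ) = 2 ^ 2 by norm_num, Real.log_pow]; norm_num
  push_cast at hcard hlower
  set s := √(9 * (n : ℝ)) with hs
  have hsq : s ^ 2 = 9 * n := Real.sq_sqrt (by positivity)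
  have hs73 : 73 ≤ s := Real.le_sqrt_of_sq_le (by linarith)
  have hlog : Real.log (9 * n) = 2 * Real.log s := by rw [← hsq, Real.log_pow]; norm_num
  have hsucc : Real.log (9 * n + 1) ≤ 2 * Real.log s + Real.log 2 := by
    rw [← hlog, ← Real.log_mul (by positivity) (by norm_num)]
    exact Real.log_le_log (by positivity) (by linarith)
  have hlogs : Real.log s ≤ s / 64 - 1 + 6 * Real.log 2 := by
    have h := Real.log_le_sub_one_of_pos (show 0 < s / 64 by positivity)
    rw [Real.log_div (by positivity) (by norm_num), show (64 : ℝ) = 2 ^ 6 by norm_num,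
      Real.log_pow] at h
    norm_num at h ⊢
    linarith
  have hlogs0 : 0 ≤ Real.log s := Real.log_nonneg (by linarith)
  have hcount : (((Finset.Ioo n (9 * n)).filter Nat.Prime).card : ℝ) ≤ 17 :=
    mod_cast Nat.le_of_lt_succ hlt
  have hl := Real.log_two_gt_d9
  have hu := Real.log_two_lt_d9
  rw [hlog] at hcard hlower
  rw [hfour] at hupper
  have hmul := mul_le_mul_of_nonneg_right hcount (mul_nonneg zero_le_two hlogs0)
  have hmain : 7 * (n : ℝ) * Real.log 2 ≤ (4 * s + 36) * Real.log s + Real.log 2 := by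
    linarith
  have hbound : (4 * s + 36) * Real.log s ≤ (4 * s + 36) * (s / 64 + 3.2) :=
    mul_le_mul_of_nonneg_left (by linarith) (by positivity)
  have hn2 : 7 * (n : ℝ) * 0.69 ≤ 7 * (n : ℝ) * Real.log 2 :=
    mul_le_mul_of_nonneg_left (by linarith) (by positivity)
  nlinarith

theorem stmt_14 (n : ℕ) (hn : 8 < n) :
    18 ≤ ((Finset.Ioo n (9 * n)).filter Nat.Prime).card := by
  rcases lt_or_ge n 11 with h₁ | h₁
  · exact le_trans (by decide +kernel)
      (card_filter_prime_Icc_le (a := 11) (b := 80) h₁ (by omega))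
  rcases lt_or_ge n 19 with h₂ | h₂
  · exact le_trans (by decide +kernel)
      (card_filter_prime_Icc_le (a := 19) (b := 98) h₂ (by omega))
  rcases lt_or_ge n 79 with h₃ | h₃
  · exact le_trans (by decide +kernel)
      (card_filter_prime_Icc_le (a := 79) (b := 170) h₃ (by omega))
  rcases lt_or_ge n 601 with h₄ | h₄
  · exact le_trans (by decide +kernel)
      (card_filter_prime_Icc_le (a := 601) (b := 710) h₄ (by omega))
  exact eighteen_le_card_of_large h₄
end

section
/- For all positive integers k and n with n ≥ k ≥ 2, there are at least k−1 prime numbers p satisfying n < p < kn. -/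
open scoped Nat.Prime

/-- Chebyshev's `ψ` at `m` bounded through the primes up to `√m`, those up to `n`, and those in
`(n, m]`. -/
theorem psi_le_card_primes_Ioc {m n : ℕ} (hm : 1 ≤ m) :
    Chebyshev.psi m ≤ ((π m.sqrt : ℝ) + (((Finset.Ioc n m).filter Nat.Prime).card : ℝ))
      * Real.log m + n * Real.log 4 := by
  have hlogm : 0 ≤ Real.log m := Real.log_natCast_nonneg m
  have hpt : ∀ p ∈ Nat.primesLE m, (Nat.log p m : ℝ) * Real.log p ≤
      (if p ≤ m.sqrt then Real.log m else 0) + (if n < p then Real.log m else 0)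
        + (if p ≤ n then Real.log p else 0) := by
    intro p hp
    have hp2 : 2 ≤ p := Nat.two_le_of_mem_primesLE hp
    have hlogp : 0 ≤ Real.log p := Real.log_natCast_nonneg p
    have hle : (Nat.log p m : ℝ) * Real.log p ≤ Real.log m :=
      Real.le_log_of_pow_le (by positivity)
        (by exact_mod_cast Nat.pow_log_le_self p (by omega))
    by_cases h1 : p ≤ m.sqrt
    · rw [if_pos h1]
      have h2 : (0 : ℝ) ≤ if n < p then Real.log m else 0 := by split_ifs <;> simp [hlogm]
      have h3 : (0 : ℝ) ≤ if p ≤ n then Real.log p else 0 := by split_ifs <;> simp [hlogp]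
      linarith
    · rw [if_neg h1]
      by_cases h2 : n < p
      · rw [if_pos h2, if_neg (by omega)]
        linarith
      · rw [if_neg h2, if_pos (by omega)]
        have h3 : Nat.log p m < 2 :=
          Nat.log_lt_of_lt_pow (by omega) (by rw [pow_two]; exact Nat.sqrt_lt.mp (by omega))
        have h4 : (Nat.log p m : ℝ) ≤ 1 := by exact_mod_cast Nat.lt_succ_iff.mp h3
        nlinarith
  have hsmall : ((Nat.primesLE m).filter (· ≤ m.sqrt)).card ≤ π m.sqrt := by
    rw [← Nat.primesLE_card_eq_primeCounting]
    refine Finset.card_le_card fun p hp => ?_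
    rw [Finset.mem_filter, Nat.mem_primesLE] at hp
    exact Nat.mem_primesLE.mpr ⟨hp.2, hp.1.2⟩
  have hlarge : (Nat.primesLE m).filter (n < ·) = (Finset.Ioc n m).filter Nat.Prime := by
    ext p
    simp only [Finset.mem_filter, Nat.mem_primesLE, Finset.mem_Ioc]
    tauto
  have hmid : ∑ p ∈ (Nat.primesLE m).filter (· ≤ n), Real.log p ≤ n * Real.log 4 := by
    rw [mul_comm]
    refine le_trans ?_ (Chebyshev.theta_le_log4_mul_x (Nat.cast_nonneg n))
    rw [Chebyshev.theta_eq_sum_primesLE_log]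
    refine Finset.sum_le_sum_of_subset_of_nonneg (fun p hp => ?_)
      fun p _ _ => Real.log_natCast_nonneg p
    rw [Finset.mem_filter, Nat.mem_primesLE] at hp
    exact Nat.mem_primesLE.mpr ⟨hp.2, hp.1.2⟩
  rw [Chebyshev.psi_eq_sum_mul_log_prime]
  refine (Finset.sum_le_sum hpt).trans ?_
  rw [Finset.sum_add_distrib, Finset.sum_add_distrib, ← Finset.sum_filter, ← Finset.sum_filter,
    ← Finset.sum_filter, hlarge, Finset.sum_const, Finset.sum_const, nsmul_eq_mul, nsmul_eq_mul,
    add_mul]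
  gcongr

theorem primeCounting_le_half_add_one (s : ℕ) : (π s : ℝ) ≤ s / 2 + 1 := by
  have h : 2 * π s ≤ s + 2 := by
    rcases Nat.lt_or_ge s 2 with hs | hs
    · have : π s = 0 := Nat.primeCounting_eq_zero_iff.mpr (by omega)
      omega
    · have h1 := Nat.primeCounting_add_le (a := 2) (k := 2) two_ne_zero le_rfl (s - 2)
      have h2 : π 2 = 1 := by decide
      rw [Nat.totient_two, h2, Nat.add_sub_cancel' hs] at h1
      omega
  have : (2 : ℝ) * π s ≤ s + 2 := by exact_mod_cast h
  linarith

theorem chebyshev_error_lt {x y : ℝ} (hx : 3 ≤ x) (hy : 512 ≤ y) (hxy : x ≤ y) :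
    (√(x * y) / 2 + x + 1) * Real.log (x * y) < (x - 2) * y * Real.log 2 := by
  have hlog2 := Real.log_two_gt_d9
  have hlog2' := Real.log_two_lt_d9
  obtain ⟨z, hz, rfl⟩ : ∃ z : ℝ, 0 ≤ z ∧ z ^ 2 = x :=
    ⟨√x, by positivity, Real.sq_sqrt (by linarith)⟩
  obtain ⟨w, hw, rfl⟩ : ∃ w : ℝ, 0 ≤ w ∧ w ^ 2 = y :=
    ⟨√y, by positivity, Real.sq_sqrt (by linarith)⟩
  have hz' : 1.732 ≤ z := by nlinarith
  have hw' : 22.6 ≤ w := by nlinarith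
  have hlogw : Real.log w ≤ w / 32 + 2.466 := by
    have h1 : Real.log (w / 32) ≤ w / 32 - 1 := Real.log_le_sub_one_of_pos (by positivity)
    have h2 : Real.log (32 : ℝ) = 5 * Real.log 2 := by
      rw [show (32 : ℝ) = 2 ^ 5 by norm_num, Real.log_pow]; norm_num
    rw [Real.log_div (by positivity) (by norm_num), h2] at h1
    linarith
  have hlog : Real.log (z ^ 2 * w ^ 2) ≤ 4 * (w / 32 + 2.466) := by
    have h1 : Real.log (z ^ 2 * w ^ 2) ≤ Real.log (w ^ 4) :=
      Real.log_le_log (by positivity) (by nlinarith [sq_nonneg w])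
    rw [Real.log_pow] at h1
    push_cast at h1
    linarith
  have hsqrt : √(z ^ 2 * w ^ 2) = z * w := by
    rw [← mul_pow, Real.sqrt_sq (by positivity)]
  have hleft : z * w / 2 + z ^ 2 + 1 ≤ z ^ 2 * (0.289 * w + 1.334) := by
    have : 0 ≤ (z - 1.732) * (z * w) := mul_nonneg (by linarith) (by positivity)
    nlinarith
  have hright : z ^ 2 * (w ^ 2 * 0.231) ≤ (z ^ 2 - 2) * w ^ 2 * Real.log 2 := by
    have h1 : z ^ 2 * w ^ 2 / 3 ≤ (z ^ 2 - 2) * w ^ 2 := by nlinarith [sq_nonneg w]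
    have h2 : 0 ≤ z ^ 2 * w ^ 2 := by positivity
    nlinarith
  have hmain : (0.289 * w + 1.334) * (4 * (w / 32 + 2.466)) < w ^ 2 * 0.231 := by nlinarith
  rw [hsqrt]
  calc (z * w / 2 + z ^ 2 + 1) * Real.log (z ^ 2 * w ^ 2)
      ≤ (z ^ 2 * (0.289 * w + 1.334)) * (4 * (w / 32 + 2.466)) := by
        gcongr
        exact Real.log_nonneg (by nlinarith)
    _ = z ^ 2 * ((0.289 * w + 1.334) * (4 * (w / 32 + 2.466))) := by ring
    _ < z ^ 2 * (w ^ 2 * 0.231) := by gcongr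
    _ ≤ _ := hright

theorem card_primes_Ioc_ge_of_large {k n : ℕ} (hk : 3 ≤ k) (hn : k ≤ n) (hn' : 512 ≤ n) :
    k - 1 ≤ ((Finset.Ioc n (k * n)).filter Nat.Prime).card := by
  by_contra! hlt
  have hm : 1536 ≤ k * n := by nlinarith
  have hpsi := (Chebyshev.psi_ge (k * n)).trans (psi_le_card_primes_Ioc (n := n) (by omega))
  have hmR : (1536 : ℝ) ≤ (k * n : ℕ) := by exact_mod_cast hm
  have hcard : (((Finset.Ioc n (k * n)).filter Nat.Prime).card : ℝ) ≤ k - 2 := by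
    rw [le_sub_iff_add_le]
    exact_mod_cast (by omega : ((Finset.Ioc n (k * n)).filter Nat.Prime).card + 2 ≤ k)
  have hsucc : Real.log ((k * n : ℕ) + 1) ≤ 2 * Real.log (k * n : ℕ) := by
    rw [← Nat.cast_two, ← Real.log_pow]
    exact Real.log_le_log (by positivity) (by nlinarith)
  have hpi : (π (k * n).sqrt : ℝ) ≤ √(k * n) / 2 + 1 := by
    have := primeCounting_le_half_add_one (k * n).sqrt
    have h := Real.nat_sqrt_le_real_sqrt (a := k * n)
    push_cast at h
    linarith
  have hlog4 : Real.log 4 = 2 * Real.log 2 := by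
    rw [show (4 : ℝ) = 2 ^ 2 by norm_num, Real.log_pow]; norm_num
  have herr := chebyshev_error_lt (x := k) (y := n) (by exact_mod_cast hk) (by exact_mod_cast hn')
    (by exact_mod_cast hn)
  have hlog : 0 ≤ Real.log (k * n : ℕ) := Real.log_natCast_nonneg _
  have hmul := mul_le_mul_of_nonneg_right (add_le_add hpi hcard) hlog
  rw [hlog4] at hpsi
  push_cast at *
  linarith

/-- The first `i` entries of `l` exceeding `n` lie below `b`, `b + n`, `b + 2 * n`, … in turn. -/
def boundedGrowth (n : ℕ) : List ℕ → ℕ → ℕ → Bool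
  | _, 0, _ => true
  | [], _ + 1, _ => false
  | p :: l, i + 1, b =>
    bif p.ble n then boundedGrowth n l (i + 1) b else p.blt b && boundedGrowth n l i (b + n)

theorem le_length_filter_of_boundedGrowth {n : ℕ} {l : List ℕ} {i b j c : ℕ}
    (h : boundedGrowth n l i b = true) (hj : j ≤ i) (hc : b + j * n ≤ c + n) :
    j ≤ (l.filter fun p => n < p ∧ p < c).length := by
  induction l generalizing i b j with
  | nil =>
    cases i with
    | zero => omega
    | succ i => simp [boundedGrowth] at h
  | cons p l ih =>
    cases j with
    | zero => exact Nat.zero_le _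
    | succ j =>
      obtain ⟨i, rfl⟩ : ∃ i', i = i' + 1 := ⟨i - 1, by omega⟩
      rw [boundedGrowth] at h
      by_cases hp : p ≤ n
      · rw [Nat.ble_eq_true_of_le hp, cond_true] at h
        rw [List.filter_cons_of_neg (by simp; omega)]
        exact ih h hj hc
      · have hble : p.ble n = false := by simpa [← Bool.not_eq_true] using hp
        rw [hble, cond_false, Bool.and_eq_true, Nat.blt_eq] at h
        rw [Nat.succ_mul] at hc
        rw [List.filter_cons_of_pos (by simp; omega), List.length_cons]
        exact Nat.succ_le_succ (ih h.2 (by omega) (by omega))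

theorem prime_of_forall_mod_ne_zero {p : ℕ} (hp : 2 ≤ p) (hp' : p < 71 ^ 2)
    (h : ∀ d < 71, 2 ≤ d → p % d = 0 → p ≤ d) : p.Prime := by
  by_contra hnp
  have h1 := Nat.minFac_sq_le_self (by omega) hnp
  have h2 : p.minFac < 71 := lt_of_pow_lt_pow_left₀ 2 (by norm_num) (h1.trans_lt hp')
  have h3 := (Nat.minFac_prime (n := p) (by omega)).two_le
  have h4 := h _ h2 h3 (Nat.mod_eq_zero_of_dvd p.minFac_dvd)
  nlinarith

/-- The primes up to 4481. -/
def smallPrimes : List ℕ :=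
  [2, 3, 5, 7, 11, 13, 17, 19, 23, 29, 31, 37, 41, 43, 47, 53, 59, 61, 67, 71, 73, 79, 83, 89,
   97, 101, 103, 107, 109, 113, 127, 131, 137, 139, 149, 151, 157, 163, 167, 173, 179, 181, 191,
   193, 197, 199, 211, 223, 227, 229, 233, 239, 241, 251, 257, 263, 269, 271, 277, 281, 283,
   293, 307, 311, 313, 317, 331, 337, 347, 349, 353, 359, 367, 373, 379, 383, 389, 397, 401,
   409, 419, 421, 431, 433, 439, 443, 449, 457, 461, 463, 467, 479, 487, 491, 499, 503, 509,
   521, 523, 541, 547, 557, 563, 569, 571, 577, 587, 593, 599, 601, 607, 613, 617, 619, 631,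
   641, 643, 647, 653, 659, 661, 673, 677, 683, 691, 701, 709, 719, 727, 733, 739, 743, 751,
   757, 761, 769, 773, 787, 797, 809, 811, 821, 823, 827, 829, 839, 853, 857, 859, 863, 877,
   881, 883, 887, 907, 911, 919, 929, 937, 941, 947, 953, 967, 971, 977, 983, 991, 997, 1009,
   1013, 1019, 1021, 1031, 1033, 1039, 1049, 1051, 1061, 1063, 1069, 1087, 1091, 1093, 1097,
   1103, 1109, 1117, 1123, 1129, 1151, 1153, 1163, 1171, 1181, 1187, 1193, 1201, 1213, 1217,
   1223, 1229, 1231, 1237, 1249, 1259, 1277, 1279, 1283, 1289, 1291, 1297, 1301, 1303, 1307,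
   1319, 1321, 1327, 1361, 1367, 1373, 1381, 1399, 1409, 1423, 1427, 1429, 1433, 1439, 1447,
   1451, 1453, 1459, 1471, 1481, 1483, 1487, 1489, 1493, 1499, 1511, 1523, 1531, 1543, 1549,
   1553, 1559, 1567, 1571, 1579, 1583, 1597, 1601, 1607, 1609, 1613, 1619, 1621, 1627, 1637,
   1657, 1663, 1667, 1669, 1693, 1697, 1699, 1709, 1721, 1723, 1733, 1741, 1747, 1753, 1759,
   1777, 1783, 1787, 1789, 1801, 1811, 1823, 1831, 1847, 1861, 1867, 1871, 1873, 1877, 1879,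
   1889, 1901, 1907, 1913, 1931, 1933, 1949, 1951, 1973, 1979, 1987, 1993, 1997, 1999, 2003,
   2011, 2017, 2027, 2029, 2039, 2053, 2063, 2069, 2081, 2083, 2087, 2089, 2099, 2111, 2113,
   2129, 2131, 2137, 2141, 2143, 2153, 2161, 2179, 2203, 2207, 2213, 2221, 2237, 2239, 2243,
   2251, 2267, 2269, 2273, 2281, 2287, 2293, 2297, 2309, 2311, 2333, 2339, 2341, 2347, 2351,
   2357, 2371, 2377, 2381, 2383, 2389, 2393, 2399, 2411, 2417, 2423, 2437, 2441, 2447, 2459,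
   2467, 2473, 2477, 2503, 2521, 2531, 2539, 2543, 2549, 2551, 2557, 2579, 2591, 2593, 2609,
   2617, 2621, 2633, 2647, 2657, 2659, 2663, 2671, 2677, 2683, 2687, 2689, 2693, 2699, 2707,
   2711, 2713, 2719, 2729, 2731, 2741, 2749, 2753, 2767, 2777, 2789, 2791, 2797, 2801, 2803,
   2819, 2833, 2837, 2843, 2851, 2857, 2861, 2879, 2887, 2897, 2903, 2909, 2917, 2927, 2939,
   2953, 2957, 2963, 2969, 2971, 2999, 3001, 3011, 3019, 3023, 3037, 3041, 3049, 3061, 3067,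
   3079, 3083, 3089, 3109, 3119, 3121, 3137, 3163, 3167, 3169, 3181, 3187, 3191, 3203, 3209,
   3217, 3221, 3229, 3251, 3253, 3257, 3259, 3271, 3299, 3301, 3307, 3313, 3319, 3323, 3329,
   3331, 3343, 3347, 3359, 3361, 3371, 3373, 3389, 3391, 3407, 3413, 3433, 3449, 3457, 3461,
   3463, 3467, 3469, 3491, 3499, 3511, 3517, 3527, 3529, 3533, 3539, 3541, 3547, 3557, 3559,
   3571, 3581, 3583, 3593, 3607, 3613, 3617, 3623, 3631, 3637, 3643, 3659, 3671, 3673, 3677,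
   3691, 3697, 3701, 3709, 3719, 3727, 3733, 3739, 3761, 3767, 3769, 3779, 3793, 3797, 3803,
   3821, 3823, 3833, 3847, 3851, 3853, 3863, 3877, 3881, 3889, 3907, 3911, 3917, 3919, 3923,
   3929, 3931, 3943, 3947, 3967, 3989, 4001, 4003, 4007, 4013, 4019, 4021, 4027, 4049, 4051,
   4057, 4073, 4079, 4091, 4093, 4099, 4111, 4127, 4129, 4133, 4139, 4153, 4157, 4159, 4177,
   4201, 4211, 4217, 4219, 4229, 4231, 4241, 4243, 4253, 4259, 4261, 4271, 4273, 4283, 4289,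
   4297, 4327, 4337, 4339, 4349, 4357, 4363, 4373, 4391, 4397, 4409, 4421, 4423, 4441, 4447,
   4451, 4457, 4463, 4481]

set_option maxRecDepth 100000 in
theorem nodup_smallPrimes : smallPrimes.Nodup := by
  have h : smallPrimes.IsChain (· < ·) := by unfold smallPrimes; decide +kernel
  exact (List.isChain_iff_pairwise.mp h).imp fun h => h.ne

set_option maxRecDepth 100000 in
theorem prime_of_mem_smallPrimes {p : ℕ} (hp : p ∈ smallPrimes) : p.Prime := by
  have h : smallPrimes.all (fun p => Nat.ble 2 p && Nat.blt p (71 ^ 2) &&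
      (List.range 71).all fun d => Nat.blt d 2 || Nat.blt 0 (p % d) || Nat.ble p d) = true := by
    decide +kernel
  have hp' := List.all_eq_true.mp h p hp
  simp only [Bool.and_eq_true, Bool.or_eq_true, List.all_eq_true, Nat.ble_eq, Nat.blt_eq,
    List.mem_range] at hp'
  refine prime_of_forall_mod_ne_zero hp'.1.1 hp'.1.2 fun d hd hd2 hmod => ?_
  have := hp'.2 d hd
  omega

set_option maxRecDepth 100000 in
theorem boundedGrowth_smallPrimes {n : ℕ} (hn : n < 512) :
    boundedGrowth n smallPrimes (n - 1) (2 * n) = true := by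
  have h : (List.range 512).all
      (fun n => boundedGrowth n smallPrimes (n - 1) (2 * n)) = true := by
    decide +kernel
  exact List.all_eq_true.mp h n (List.mem_range.mpr hn)

theorem card_primes_Ioo_ge_of_small {k n : ℕ} (hk : 2 ≤ k) (hn : k ≤ n) (hn' : n < 512) :
    k - 1 ≤ ((Finset.Ioo n (k * n)).filter Nat.Prime).card := by
  obtain ⟨j, rfl⟩ : ∃ j, k = j + 1 := ⟨k - 1, by omega⟩
  have h := le_length_filter_of_boundedGrowth (j := j) (c := (j + 1) * n)
    (boundedGrowth_smallPrimes hn') (by omega) (by linarith)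
  refine h.trans ?_
  rw [← List.toFinset_card_of_nodup (nodup_smallPrimes.filter _)]
  refine Finset.card_le_card fun p hp => ?_
  rw [List.mem_toFinset, List.mem_filter, decide_eq_true_eq] at hp
  exact Finset.mem_filter.mpr ⟨Finset.mem_Ioo.mpr hp.2, prime_of_mem_smallPrimes hp.1⟩

theorem filter_prime_Ioo_mul_eq_Ioc {k n : ℕ} (hk : 2 ≤ k) (hn : 2 ≤ n) :
    (Finset.Ioo n (k * n)).filter Nat.Prime = (Finset.Ioc n (k * n)).filter Nat.Prime := by
  ext p
  simp only [Finset.mem_filter, Finset.mem_Ioo, Finset.mem_Ioc]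
  refine ⟨fun h => ⟨⟨h.1.1, h.1.2.le⟩, h.2⟩, fun h => ⟨⟨h.1.1, h.1.2.lt_of_ne ?_⟩, h.2⟩⟩
  rintro rfl
  exact Nat.not_prime_mul (by omega) (by omega) h.2

theorem stmt_17 (k n : ℕ) (hk : 2 ≤ k) (hn : k ≤ n) :
    k - 1 ≤ ((Finset.Ioo n (k * n)).filter Nat.Prime).card := by
  rcases Nat.lt_or_ge n 512 with hn' | hn'
  · exact card_primes_Ioo_ge_of_small hk hn hn'
  rw [filter_prime_Ioo_mul_eq_Ioc hk (hk.trans hn)]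
  rcases hk.eq_or_lt with rfl | hk'
  · obtain ⟨p, hp, hlt, hle⟩ := Nat.exists_prime_lt_and_le_two_mul n (by omega)
    exact Finset.card_pos.mpr
      ⟨p, Finset.mem_filter.mpr ⟨Finset.mem_Ioc.mpr ⟨hlt, hle⟩, hp⟩⟩
  · exact card_primes_Ioc_ge_of_large hk' hn hn'
end
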